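/- Assume the Riemann Hypothesis. Then for all real x > 2, one has π(x) ≤ (1 + 7/log x) · A(x) and A(x) ≤ (1 + 7/log x) · π(x), where A(x) := x(1/log x + 1/log² x) − 2/log 2; that is, π(x) is within a factor of 1 + 7/log x of A(x). -/

import Mathlib

/-- The number of primes `p ≤ x`, for a real argument `x`. -/
noncomputable def primePi (x : ℝ) : ℕ := Nat.primeCounting ⌊x⌋₊

/-- The approximation `A(x) := x (1/log x + 1/log² x) − 2/log 2`. -/
noncomputable def approxA (x : ℝ) : ℝ :=
  x * (1 / Real.log x + 1 / (Real.log x) ^ 2) - 2 / Real.log 2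

section RHProof

open Complex MeasureTheory Set Filter Topology Asymptotics


noncomputable def fI (t : ℝ) : ℂ := (Ioi (1:ℝ)).indicator (fun t => ((Int.fract t : ℝ) : ℂ)) t

lemma fI_norm_le (t : ℝ) : ‖fI t‖ ≤ 1 := by
  unfold fI
  by_cases h : t ∈ Ioi (1:ℝ)
  · rw [indicator_of_mem h, norm_real, Real.norm_eq_abs, Int.abs_fract]
    exact (Int.fract_lt_one t).le
  · rw [indicator_of_notMem h]; simp

lemma fI_meas : Measurable fI := by
  unfold fI
  exact (measurable_ofReal.comp measurable_fract).indicator measurableSet_Ioi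

lemma fI_loc : LocallyIntegrableOn fI (Ioi 0) := by
  have h : LocallyIntegrable (fun _ : ℝ => (1:ℝ)) := locallyIntegrable_const _
  refine (h.mono fI_meas.aestronglyMeasurable ?_).locallyIntegrableOn _
  filter_upwards with t
  simpa using fI_norm_le t

lemma fI_top : fI =O[atTop] fun x : ℝ => x ^ (-(0:ℝ)) := by
  refine IsBigO.of_bound 1 ?_
  filter_upwards with t
  simpa using fI_norm_le t

lemma fI_bot (b : ℝ) : fI =O[𝓝[>] 0] fun x : ℝ => x ^ (-b) := by
  refine IsBigO.of_bound 1 ?_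
  have : ∀ᶠ t in 𝓝[>] (0:ℝ), t < 1 := nhdsWithin_le_nhds (eventually_lt_nhds one_pos)
  filter_upwards [this] with t ht
  have : fI t = 0 := by unfold fI; rw [indicator_of_notMem]; simp; linarith
  rw [this]; simp

lemma fI_diff {s : ℂ} (hs : 0 < s.re) : DifferentiableAt ℂ (fun s => mellin fI (-s)) s := by
  have : DifferentiableAt ℂ (mellin fI) (-s) :=
    mellin_differentiableAt_of_isBigO_rpow fI_loc fI_top (by simpa using hs)
      (fI_bot (-s.re - 1)) (by simp)
  exact this.comp s (differentiableAt_id.neg)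

lemma fI_mellin (s : ℂ) : mellin fI (-s) = ∫ t in Ioi (1:ℝ), ((Int.fract t : ℝ) : ℂ) * (t:ℂ) ^ (-(s+1)) := by
  unfold mellin fI
  have h1 : ∀ t : ℝ, (t:ℂ) ^ (-s - 1) • (Ioi (1:ℝ)).indicator (fun t => ((Int.fract t : ℝ) : ℂ)) t
     = (Ioi (1:ℝ)).indicator (fun t : ℝ => ((Int.fract t : ℝ) : ℂ) * (t:ℂ) ^ (-(s+1))) t := by
    intro t
    by_cases h : t ∈ Ioi (1:ℝ)
    · simp only [indicator_of_mem h, smul_eq_mul]; rw [mul_comm]; congr 2; ring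
    · simp only [indicator_of_notMem h, smul_zero]
  simp_rw [h1]
  rw [setIntegral_indicator measurableSet_Ioi]
  rw [inter_eq_right.mpr (Ioi_subset_Ioi zero_le_one)]

lemma fI_bound {s : ℂ} (hs : 1/2 ≤ s.re) : ‖mellin fI (-s)‖ ≤ 2 := by
  rw [fI_mellin]
  have hint : IntegrableOn (fun t : ℝ => t ^ (-(s.re+1))) (Ioi 1) :=
    integrableOn_Ioi_rpow_of_lt (by linarith) one_pos
  calc _ ≤ ∫ t in Ioi (1:ℝ), t ^ (-(s.re+1)) := by
        refine norm_integral_le_of_norm_le hint ?_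
        filter_upwards [ae_restrict_mem measurableSet_Ioi] with t ht
        have ht0 : (0:ℝ) < t := lt_trans one_pos ht
        rw [norm_mul, norm_cpow_eq_rpow_re_of_pos ht0, norm_real, Real.norm_eq_abs, Int.abs_fract]
        have := (Int.fract_lt_one t).le
        have h2 : 0 ≤ t ^ (-(s.re+1)) := by positivity
        simp only [neg_re, add_re, one_re]
        nlinarith
    _ = 1 / s.re := by
        rw [integral_Ioi_rpow_of_lt (by linarith) one_pos]
        simp
    _ ≤ 2 := by rw [div_le_iff₀ (by linarith)]; linarith

lemma zeta_eq_int {s : ℂ} (hs : 1 < s.re) :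
    riemannZeta s = s * ∫ t in Ioi (1:ℝ), ((⌊t⌋₊:ℝ):ℂ) * (t:ℂ) ^ (-(s+1)) := by
  rw [← LSeries_one_eq_riemannZeta hs]
  rw [LSeries_eq_mul_integral 1 zero_le_one hs (LSeriesSummable_one_iff.mpr hs)]
  · simp
  · refine IsBigO.of_bound 1 ?_
    filter_upwards with n
    simp

lemma zeta1_eq_of_one_lt {s : ℂ} (hs : 1 < s.re) :
    riemannZeta₁ s = s - s * (s - 1) * mellin fI (-s) := by
  have hs1 : s ≠ 1 := by rintro rfl; simp at hs
  have hs1' : s - 1 ≠ 0 := sub_ne_zero.mpr hs1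
  have hz := riemannZeta_eq_inv_sub_mul hs1
  have hi1 : IntegrableOn (fun t : ℝ => (t:ℂ) ^ (-s)) (Ioi 1) :=
    integrableOn_Ioi_cpow_of_lt (by simpa using hs) one_pos
  have e1 : ∫ t in Ioi (1:ℝ), (t:ℂ) ^ (-s) = 1 / (s-1) := by
    rw [integral_Ioi_cpow_of_lt (by simpa using hs) one_pos]
    simp
    rw [← neg_div_neg_eq]; simp [neg_add_eq_sub]
  have hi2 : IntegrableOn (fun t : ℝ => ((Int.fract t : ℝ) : ℂ) * (t:ℂ) ^ (-(s+1))) (Ioi 1) := by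
    have hint : IntegrableOn (fun t : ℝ => t ^ (-(s.re+1))) (Ioi 1) :=
      integrableOn_Ioi_rpow_of_lt (by linarith) one_pos
    refine hint.mono' ?_ ?_
    · refine AEStronglyMeasurable.mul (measurable_ofReal.comp measurable_fract).aestronglyMeasurable ?_
      refine ContinuousOn.aestronglyMeasurable ?_ measurableSet_Ioi
      intro t ht
      have ht0 : (0:ℝ) < t := lt_trans one_pos ht
      refine ContinuousAt.continuousWithinAt ?_
      exact (continuousAt_ofReal_cpow_const _ _ (Or.inr ht0.ne'))
    · filter_upwards [ae_restrict_mem measurableSet_Ioi] with t ht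
      have ht0 : (0:ℝ) < t := lt_trans one_pos ht
      rw [norm_mul, norm_cpow_eq_rpow_re_of_pos ht0, norm_real, Real.norm_eq_abs, Int.abs_fract]
      have := (Int.fract_lt_one t).le
      have h2 : 0 ≤ t ^ (-(s.re+1)) := by positivity
      simp only [neg_re, add_re, one_re]
      nlinarith
  have e2 : ∫ t in Ioi (1:ℝ), ((⌊t⌋₊:ℝ):ℂ) * (t:ℂ) ^ (-(s+1)) = 1/(s-1) - mellin fI (-s) := by
    rw [← e1, fI_mellin, ← integral_sub hi1 hi2]
    refine setIntegral_congr_fun measurableSet_Ioi ?_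
    intro t ht
    have ht0 : (0:ℝ) < t := lt_trans one_pos ht
    have hf : Int.fract t = t - (⌊t⌋₊:ℝ) := by
      rw [natCast_floor_eq_intCast_floor ht0.le]; rfl
    have : (t:ℂ) ^ (-s) = t * (t:ℂ) ^ (-(s+1)) := by
      have h0 : (t:ℂ) ≠ 0 := by exact_mod_cast ht0.ne'
      have := cpow_add (x := (t:ℂ)) 1 (-(s+1)) h0
      rw [cpow_one] at this
      rw [← this]; congr 1; ring
    simp only [hf, this]; push_cast; ring
  have := zeta_eq_int hs
  rw [e2] at this
  rw [hz] at this
  field_simp at this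
  linear_combination this

lemma zeta1_eq {s : ℂ} (hs : 0 < s.re) :
    riemannZeta₁ s = s - s * (s - 1) * mellin fI (-s) := by
  have hop : IsOpen {s : ℂ | 0 < s.re} := isOpen_lt continuous_const continuous_re
  have hconn : IsPreconnected {s : ℂ | 0 < s.re} := (convex_halfSpace_re_gt 0).isPreconnected
  have h1 : AnalyticOnNhd ℂ riemannZeta₁ {s : ℂ | 0 < s.re} :=
    (differentiable_riemannZeta₁.differentiableOn).analyticOnNhd hop
  have h2 : AnalyticOnNhd ℂ (fun s => s - s * (s - 1) * mellin fI (-s)) {s : ℂ | 0 < s.re} := by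
    refine DifferentiableOn.analyticOnNhd ?_ hop
    intro z hz
    refine DifferentiableAt.differentiableWithinAt ?_
    have := fI_diff hz
    fun_prop
  refine h1.eqOn_of_preconnected_of_eventuallyEq h2 hconn (z₀ := 2) (by simp) ?_ hs
  have : {s : ℂ | 1 < s.re} ∈ 𝓝 (2:ℂ) :=
    (isOpen_lt continuous_const continuous_re).mem_nhds (by simp)
  filter_upwards [this] with z hz using zeta1_eq_of_one_lt hz

lemma zeta1_bound {s : ℂ} (hs : 1/2 ≤ s.re) :
    ‖riemannZeta₁ s‖ ≤ ‖s‖ * (1 + 2 * ‖s - 1‖) := by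
  rw [zeta1_eq (by linarith)]
  calc _ ≤ ‖s‖ + ‖s * (s-1) * mellin fI (-s)‖ := norm_sub_le _ _
    _ ≤ _ := by
      rw [norm_mul, norm_mul]
      have := mul_le_mul_of_nonneg_left (fI_bound hs) (by positivity : 0 ≤ ‖s‖ * ‖s-1‖)
      nlinarith

lemma zeta1_ne (hRH : RiemannHypothesis) {s : ℂ} (hs : 1/2 < s.re) : riemannZeta₁ s ≠ 0 := by
  by_cases h1 : s = 1
  · subst h1; simp
  intro h
  have hz := riemannZeta_eq_inv_sub_mul h1
  rw [h, mul_zero] at hz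
  have := hRH s hz ?_ h1
  · linarith
  · rintro ⟨n, rfl⟩
    simp at hs
    have : (0:ℝ) ≤ n := by positivity
    linarith



lemma zeta_lower {s : ℂ} (hs : s.re = 2) : 1/3 ≤ ‖riemannZeta s‖ := by
  have h2 : HasSum (fun n : ℕ => 1 / ((n:ℝ) + 2)^2) (Real.pi^2/6 - 1) := by
    have := (hasSum_nat_add_iff' 2).mpr hasSum_zeta_two
    simpa [Finset.sum_range_succ] using this
  have hsum : Summable (fun n : ℕ => 1 / (n : ℂ) ^ s) :=
    Complex.summable_one_div_nat_cpow.mpr (by linarith)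
  have hz := zeta_eq_tsum_one_div_nat_cpow (s := s) (by linarith)
  rw [← hsum.sum_add_tsum_nat_add 2] at hz
  have hs0 : s ≠ 0 := by rintro rfl; simp at hs
  have hb : ‖∑' n : ℕ, 1 / ((n + 2 : ℕ) : ℂ) ^ s‖ ≤ Real.pi^2/6 - 1 := by
    refine tsum_of_norm_bounded h2 ?_
    intro n
    rw [norm_div, norm_one, norm_natCast_cpow_of_pos (by omega), hs]
    apply le_of_eq; push_cast; norm_cast
  have e : riemannZeta s = 1 + ∑' n : ℕ, 1 / ((n + 2 : ℕ) : ℂ) ^ s := by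
    rw [hz]; simp [Finset.sum_range_succ, hs0]
  have hpi : Real.pi^2/6 - 1 ≤ 2/3 := by
    have := Real.pi_lt_d4
    have := Real.pi_pos
    nlinarith
  have h3 : ‖(1:ℂ)‖ ≤ ‖riemannZeta s‖ + ‖∑' n : ℕ, 1 / ((n + 2 : ℕ) : ℂ) ^ s‖ := by
    have : (1:ℂ) = riemannZeta s - ∑' n : ℕ, 1 / ((n + 2 : ℕ) : ℂ) ^ s := by rw [e]; ring
    calc ‖(1:ℂ)‖ = ‖riemannZeta s - ∑' n : ℕ, 1 / ((n + 2 : ℕ) : ℂ) ^ s‖ := by rw [← this]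
      _ ≤ _ := norm_sub_le _ _
  rw [norm_one] at h3
  linarith

/-- The general log-derivative estimate. -/
lemma logDeriv_bound_aux {F : ℂ → ℂ} (hF : Differentiable ℂ F) {c w : ℂ} {M : ℝ} (hM : 0 < M)
    (hne : ∀ z ∈ Metric.ball c (3/2), F z ≠ 0)
    (hb : ∀ z ∈ Metric.ball c (3/2), ‖F z‖ ≤ Real.exp M * ‖F c‖)
    (hw : ‖w - c‖ ≤ 4/3) : ‖deriv F w / F w‖ ≤ 408 * M := by
  have hd : DifferentiableOn ℂ (fun z => deriv F z / F z) (Metric.ball c (3/2)) := by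
    refine DifferentiableOn.div ?_ hF.differentiableOn hne
    exact (hF.differentiableOn (s := univ) |>.deriv isOpen_univ).mono (subset_univ _)
  obtain ⟨g, hg0, hg⟩ := hd.isExactOn_ball.with_val_at c 0
  have hc : c ∈ Metric.ball c (3/2 : ℝ) := Metric.mem_ball_self (by norm_num)
  have hgd : DifferentiableOn ℂ g (Metric.ball c (3/2)) :=
    fun z hz => (hg z hz).differentiableAt.differentiableWithinAt
  -- F * exp (-g) is constant
  have hconst : ∀ z ∈ Metric.ball c (3/2), F z * exp (-g z) = F c := by
    intro z hz
    have hder : ∀ u ∈ Metric.ball c (3/2), HasDerivAt (fun z => F z * exp (-g z)) 0 u := by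
      intro u hu
      have h1 := (hF u).hasDerivAt
      have h2 := ((hg u hu).neg).cexp
      have h3 := h1.mul h2
      refine h3.congr_deriv ?_
      have := hne u hu
      simp only [Pi.neg_apply]
      field_simp
      ring
    have := (Metric.isOpen_ball (x := c) (ε := 3/2)).is_const_of_deriv_eq_zero
      (convex_ball c (3/2)).isPreconnected
      (fun u hu => (hder u hu).differentiableAt.differentiableWithinAt)
      (fun u hu => (hder u hu).deriv) hz hc
    simpa [hg0] using this
  have hre : ∀ z ∈ Metric.ball c (3/2), (g z).re ≤ M := by
    intro z hz
    have h1 := hconst z hz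
    have hFc : 0 < ‖F c‖ := norm_pos_iff.mpr (hne c hc)
    have h2 : ‖F z‖ = ‖F c‖ * Real.exp ((g z).re) := by
      have : F z = F c * exp (g z) := by
        rw [← h1, mul_assoc, ← Complex.exp_add]; simp
      rw [this, norm_mul, Complex.norm_exp]
    have h3 := hb z hz
    rw [h2, mul_comm] at h3
    have := le_of_mul_le_mul_right h3 hFc
    exact Real.exp_le_exp.mp this
  have hgb : ∀ z, ‖z - c‖ ≤ 17/12 → ‖g z‖ ≤ 34 * M := by
    intro z hz
    have hmem : ∀ u ∈ Metric.ball (0:ℂ) (3/2), c + u ∈ Metric.ball c (3/2) := by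
      intro u hu; simpa using hu
    have := borelCaratheodory_zero (f := fun u => g (c + u)) (R := 3/2) (z := z - c) hM
      (hgd.comp (by fun_prop) hmem) (fun u hu => hre _ (hmem u hu)) (by norm_num)
      (by simp; linarith) (by simpa using hg0)
    simp only [add_sub_cancel] at this
    refine this.trans ?_
    rw [div_le_iff₀ (by linarith)]
    nlinarith
  have hwb : w ∈ Metric.ball c (3/2) := by
    rw [Metric.mem_ball, dist_eq_norm]; linarith
  rw [← (hg w hwb).deriv]
  have hsub : Metric.closedBall w (1/12) ⊆ Metric.ball c (3/2) := by
    intro z hz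
    rw [Metric.mem_closedBall, dist_eq_norm] at hz
    rw [Metric.mem_ball, dist_eq_norm]
    have : z - c = (z - w) + (w - c) := by ring
    rw [this]
    linarith [norm_add_le (z-w) (w-c)]
  have := norm_deriv_le_of_forall_mem_sphere_norm_le (c := w) (R := 1/12) (C := 34 * M) (f := g)
    (by norm_num) ((hgd.mono hsub).diffContOnCl_ball (subset_refl _)) ?_
  · refine this.trans (le_of_eq ?_); ring
  · intro z hz
    apply hgb
    rw [mem_sphere_iff_norm] at hz
    have : z - c = (z - w) + (w - c) := by ring
    rw [this]
    linarith [norm_add_le (z-w) (w-c)]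

lemma log_aux {u : ℝ} (hu : 1 ≤ u) : Real.log (64 * u) ≤ 4.2 * √u := by
  rw [Real.log_mul (by norm_num) (by linarith)]
  have h1 : Real.log 64 ≤ 4.2 := by
    have : (64:ℝ) = 2^6 := by norm_num
    rw [this, Real.log_pow]
    have := Real.log_two_lt_d9
    push_cast; linarith
  have h2 : Real.log u = 2 * Real.log (√u) := by
    rw [Real.log_sqrt (by linarith)]; ring
  have h3 : 1 ≤ √u := by rw [Real.one_le_sqrt]; exact hu
  have h4 := Real.log_le_sub_one_of_pos (by linarith : 0 < √u)
  nlinarith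

lemma logDeriv_bound (hRH : RiemannHypothesis) {σ t : ℝ} (h1 : 2/3 ≤ σ) (h2 : σ ≤ 2) :
    ‖deriv riemannZeta₁ (σ + t * I) / riemannZeta₁ (σ + t * I)‖ ≤ 1720 * √(1 + |t|) := by
  set c : ℂ := 2 + t * I with hc
  have hcre : c.re = 2 := by simp [hc]
  have hu : 1 ≤ 1 + |t| := by linarith [abs_nonneg t]
  have hMpos : 0 < Real.log (64 * (1 + |t|)) := Real.log_pos (by linarith)
  have hball : ∀ z ∈ Metric.ball c (3/2), 1/2 < z.re := by
    intro z hz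
    rw [Metric.mem_ball, dist_eq_norm] at hz
    have := (abs_re_le_norm (z - c))
    rw [sub_re, hcre] at this
    have := (abs_le.mp (this.trans hz.le)).1
    have h' := lt_of_le_of_lt (abs_re_le_norm (z - c)) hz
    rw [sub_re, hcre] at h'
    have := (abs_lt.mp h').1
    linarith
  have key := logDeriv_bound_aux differentiable_riemannZeta₁ (c := c) (w := σ + t * I) hMpos
    (fun z hz => zeta1_ne hRH (hball z hz)) ?_ ?_
  · refine key.trans ?_
    have := log_aux hu
    have : 0 ≤ √(1 + |t|) := by positivity
    nlinarith
  · intro z hz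
    rw [Real.exp_log (by linarith)]
    refine (zeta1_bound (hball z hz).le).trans ?_
    have hc1 : c ≠ 1 := by intro h; rw [h] at hcre; simp at hcre
    have hcm : c - 1 ≠ 0 := sub_ne_zero.mpr hc1
    have hFc : ‖c - 1‖ * (1/3) ≤ ‖riemannZeta₁ c‖ := by
      have h := riemannZeta_eq_inv_sub_mul hc1
      have : riemannZeta₁ c = (c - 1) * riemannZeta c := by rw [h]; field_simp
      rw [this, norm_mul]
      exact mul_le_mul_of_nonneg_left (zeta_lower hcre) (norm_nonneg _)
    rw [Metric.mem_ball, dist_eq_norm] at hz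
    have hz1 : ‖z‖ ≤ ‖c‖ + 3/2 := by
      have : z = (z - c) + c := by ring
      rw [this]; linarith [norm_add_le (z - c) c]
    have hz2 : ‖z - 1‖ ≤ ‖c - 1‖ + 3/2 := by
      have : z - 1 = (z - c) + (c - 1) := by ring
      rw [this]; linarith [norm_add_le (z - c) (c - 1)]
    have hcn : ‖c‖ ≤ 2 + |t| := by
      refine (norm_add_le _ _).trans ?_
      simp
    have hcm1 : 1 ≤ ‖c - 1‖ := by
      have := abs_re_le_norm (c - 1)
      rw [sub_re, hcre] at this
      norm_num at this
      exact this
    have ht := abs_nonneg t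
    calc ‖z‖ * (1 + 2 * ‖z - 1‖) ≤ (‖c‖ + 3/2) * (1 + 2 * (‖c-1‖ + 3/2)) := by gcongr
      _ ≤ (2 + |t| + 3/2) * (6 * ‖c - 1‖) := by gcongr; linarith
      _ ≤ 64 * (1 + |t|) * (‖c - 1‖ * (1/3)) := by nlinarith
      _ ≤ _ := by gcongr
  · have : (σ:ℂ) + t * I - c = ((σ - 2 : ℝ) : ℂ) := by rw [hc]; push_cast; ring
    rw [this, norm_real, Real.norm_eq_abs, abs_le]
    constructor <;> linarith



noncomputable def kA (t : ℝ) : ℂ := ((max (1 - t) 0 : ℝ) : ℂ)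
noncomputable def kB (t : ℝ) : ℂ := (((max (1 - t) 0) ^ 2 / 2 : ℝ) : ℂ)

lemma hasMellin_congr_Ioi {f g : ℝ → ℂ} {s m : ℂ} (h : ∀ t ∈ Ioi (0:ℝ), f t = g t)
    (hf : HasMellin f s m) : HasMellin g s m := by
  obtain ⟨h1, h2⟩ := hf
  have e : EqOn (fun t : ℝ => (t:ℂ) ^ (s - 1) • f t) (fun t : ℝ => (t:ℂ) ^ (s - 1) • g t) (Ioi 0) := by
    intro t ht; simp only [h t ht]
  refine ⟨?_, ?_⟩
  · exact (IntegrableOn.congr_fun h1 e measurableSet_Ioi)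
  · rw [← h2]; exact (setIntegral_congr_fun measurableSet_Ioi e).symm

lemma kA_mellin {s : ℂ} (hs : 0 < s.re) : HasMellin kA s (1 / (s * (s + 1))) := by
  have h1 := hasMellin_one_Ioc hs
  have h2 := hasMellin_cpow_Ioc 1 (s := s) (by simp; linarith)
  have h3 := hasMellin_sub h1.1 h2.1
  rw [h1.2, h2.2] at h3
  have hs0 : s ≠ 0 := by rintro rfl; simp at hs
  have hs1 : s + 1 ≠ 0 := by
    intro h; have := congrArg re h; simp at this; linarith
  have e : 1 / s - 1 / (s + 1) = 1 / (s * (s + 1)) := by field_simp; ring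
  rw [e] at h3
  refine hasMellin_congr_Ioi ?_ h3
  intro t ht
  have ht' : (0:ℝ) < t := ht
  by_cases h : t ≤ 1
  · have hm : t ∈ Ioc (0:ℝ) 1 := ⟨ht, h⟩
    simp only [indicator_of_mem hm, kA]
    rw [max_eq_left (by linarith)]; push_cast; simp
  · have hm : t ∉ Ioc (0:ℝ) 1 := fun h' => h h'.2
    simp only [indicator_of_notMem hm, kA]
    rw [max_eq_right (by linarith)]; simp

lemma kB_mellin {s : ℂ} (hs : 0 < s.re) : HasMellin kB s (1 / (s * (s + 1) * (s + 2))) := by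
  have h1 := hasMellin_one_Ioc hs
  have h2 := hasMellin_cpow_Ioc 1 (s := s) (by simp; linarith)
  have h2' := hasMellin_cpow_Ioc 2 (s := s) (by simp; linarith)
  have h3 := hasMellin_sub h1.1 h2.1
  have h3' := hasMellin_sub h2.1 h2'.1
  have h4 := hasMellin_sub h3.1 h3'.1
  have h5 := hasMellin_const_smul h4.1 (1/2 : ℂ)
  rw [h4.2, h3.2, h3'.2, h1.2, h2.2, h2'.2] at h5
  have hs0 : s ≠ 0 := by rintro rfl; simp at hs
  have hs1 : s + 1 ≠ 0 := by
    intro h; have := congrArg re h; simp at this; linarith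
  have hs2 : s + 2 ≠ 0 := by
    intro h; have := congrArg re h; simp at this; linarith
  have e : (1/2 : ℂ) • (1 / s - 1 / (s + 1) - (1 / (s+1) - 1 / (s+2)))
      = 1 / (s * (s + 1) * (s + 2)) := by
    rw [smul_eq_mul]; field_simp; ring
  rw [e] at h5
  refine hasMellin_congr_Ioi ?_ h5
  intro t ht
  have ht' : (0:ℝ) < t := ht
  by_cases h : t ≤ 1
  · have hm : t ∈ Ioc (0:ℝ) 1 := ⟨ht, h⟩
    simp only [indicator_of_mem hm, kB]
    rw [max_eq_left (by linarith)]
    push_cast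
    rw [smul_eq_mul, cpow_one, cpow_ofNat]; ring
  · have hm : t ∉ Ioc (0:ℝ) 1 := fun h' => h h'.2
    simp only [indicator_of_notMem hm, kB]
    rw [max_eq_right (by linarith)]; simp

lemma norm_sq_line (σ t : ℝ) : ‖(σ:ℂ) + t * I‖ ^ 2 = σ ^ 2 + t ^ 2 := by
  rw [Complex.sq_norm, normSq_add_mul_I]

lemma line_ne {σ t : ℝ} (h : 0 < σ) : (σ:ℂ) + t * I ≠ 0 := by
  intro h'; have := congrArg re h'; simp at this; linarith

lemma inv_line_bound {σ τ t : ℝ} (h1 : 1 ≤ σ) (h2 : 1 ≤ τ) :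
    ‖1 / (((σ:ℂ) + t * I) * ((τ:ℂ) + t * I))‖ ≤ (1 + t ^ 2)⁻¹ := by
  rw [norm_div, norm_one, norm_mul, one_div]
  have ha := norm_sq_line σ t
  have hb := norm_sq_line τ t
  apply inv_anti₀ (by positivity)
  have : (1 + t^2)^2 ≤ (‖(σ:ℂ) + t * I‖ * ‖(τ:ℂ) + t * I‖) ^ 2 := by
    rw [mul_pow, ha, hb, sq]
    gcongr <;> nlinarith
  exact le_of_sq_le_sq this (by positivity)

lemma integrable_line2 {σ τ : ℝ} (h1 : 1 ≤ σ) (h2 : 1 ≤ τ) :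
    Integrable (fun t : ℝ => 1 / (((σ:ℂ) + t * I) * ((τ:ℂ) + t * I))) := by
  refine integrable_inv_one_add_sq.mono' ?_ ?_
  · refine Continuous.aestronglyMeasurable ?_
    refine Continuous.div continuous_const (by fun_prop) ?_
    intro t
    exact mul_ne_zero (line_ne (by linarith)) (line_ne (by linarith))
  · filter_upwards with t using inv_line_bound h1 h2

lemma integrable_line3 {σ τ υ : ℝ} (h1 : 1 ≤ σ) (h2 : 1 ≤ τ) (h3 : 1 ≤ υ) :
    Integrable (fun t : ℝ => 1 / (((σ:ℂ) + t * I) * ((τ:ℂ) + t * I) * ((υ:ℂ) + t * I))) := by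
  refine (integrable_line2 h1 h2).mono ?_ ?_
  · refine Continuous.aestronglyMeasurable ?_
    refine Continuous.div continuous_const (by fun_prop) ?_
    intro t
    exact mul_ne_zero (mul_ne_zero (line_ne (by linarith)) (line_ne (by linarith)))
      (line_ne (by linarith))
  · filter_upwards with t
    rw [norm_div, norm_div, norm_mul _ ((υ:ℂ) + t * I)]
    have hpos : 0 < ‖((σ:ℂ) + t * I) * ((τ:ℂ) + t * I)‖ :=
      norm_pos_iff.mpr (mul_ne_zero (line_ne (by linarith)) (line_ne (by linarith)))
    have hv : 1 ≤ ‖(υ:ℂ) + t * I‖ := by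
      have := norm_sq_line υ t
      by_contra hcon
      push Not at hcon
      nlinarith [norm_nonneg ((υ:ℂ) + t * I)]
    gcongr
    nlinarith

lemma kA_inv {y : ℝ} (hy : 0 < y) :
    (1 / (2 * Real.pi) : ℂ) * ∫ t : ℝ, (y:ℂ) ^ (-(2 + t * I)) * (1 / ((2 + t * I) * (3 + t * I)))
      = ((max (1 - y) 0 : ℝ) : ℂ) := by
  have hm : ∀ t : ℝ, mellin kA ((2:ℝ) + t * I) = 1 / ((2 + t * I) * (3 + t * I)) := by
    intro t
    rw [(kA_mellin (by simp)).2]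
    congr 2; push_cast; ring
  have h := mellinInv_mellin_eq 2 kA hy (by exact_mod_cast (kA_mellin (s := 2) (by simp)).1) ?_ ?_
  · rw [mellinInv] at h
    rw [show ((max (1 - y) 0 : ℝ) : ℂ) = kA y from rfl, ← h]
    simp_rw [hm]
    simp [smul_eq_mul]
  · rw [VerticalIntegrable]
    simp_rw [hm]
    exact_mod_cast integrable_line2 (σ := 2) (τ := 3) (by norm_num) (by norm_num)
  · unfold kA; fun_prop

lemma kB_inv {y : ℝ} (hy : 0 < y) :
    (1 / (2 * Real.pi) : ℂ) * ∫ t : ℝ, (y:ℂ) ^ (-(1 + t * I)) *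
      (1 / ((1 + t * I) * (2 + t * I) * (3 + t * I)))
      = (((max (1 - y) 0)^2/2 : ℝ) : ℂ) := by
  have hm : ∀ t : ℝ, mellin kB ((1:ℝ) + t * I) = 1 / ((1 + t * I) * (2 + t * I) * (3 + t * I)) := by
    intro t
    rw [(kB_mellin (by simp)).2]
    congr 2
    · push_cast; ring
    · push_cast; ring
  have h := mellinInv_mellin_eq 1 kB hy (by exact_mod_cast (kB_mellin (s := 1) (by simp)).1) ?_ ?_
  · rw [mellinInv] at h
    rw [show (((max (1 - y) 0)^2/2 : ℝ) : ℂ) = kB y from rfl, ← h]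
    simp_rw [hm]
    simp [smul_eq_mul]
  · rw [VerticalIntegrable]
    simp_rw [hm]
    exact_mod_cast integrable_line3 (σ := 1) (τ := 2) (υ := 3) (by norm_num) (by norm_num) (by norm_num)
  · unfold kB; fun_prop



/-- The integrand of the explicit formula. -/
noncomputable def PhiX (x : ℝ) (w : ℂ) : ℂ :=
  (x:ℂ) ^ w * (-(deriv riemannZeta₁ w / riemannZeta₁ w)) / (w * (w + 1))

lemma line2_int : Integrable (fun t : ℝ => 1 / (((2:ℂ) + t * I) * ((3:ℂ) + t * I))) := by
  exact_mod_cast integrable_line2 (σ := 2) (τ := 3) (by norm_num) (by norm_num)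

lemma integrable_cpow_line {y : ℝ} (hy : 0 < y) (σ : ℝ) {g : ℝ → ℂ} (hg : Integrable g) :
    Integrable (fun t : ℝ => (y:ℂ) ^ (-((σ:ℂ) + t * I)) * g t) := by
  have hy0 : (y:ℂ) ≠ 0 := by exact_mod_cast hy.ne'
  have : Continuous (fun t : ℝ => (y:ℂ) ^ (-((σ:ℂ) + t * I))) := by
    refine Continuous.const_cpow (by fun_prop) (Or.inl hy0)
  refine hg.bdd_mul (c := y ^ (-σ)) this.aestronglyMeasurable ?_
  filter_upwards with t
  rw [norm_cpow_eq_rpow_re_of_pos hy]; simp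

lemma psum_formula {x : ℝ} (hx : 1 < x) :
    Integrable (fun t : ℝ => (x:ℂ) ^ ((2:ℂ) + t * I) *
      LSeries (fun n => (ArithmeticFunction.vonMangoldt n : ℂ)) (2 + t * I) /
        ((2 + t * I) * (3 + t * I))) ∧
    HasSum (fun n : ℕ => ((ArithmeticFunction.vonMangoldt n * max (1 - n / x) 0 : ℝ) : ℂ))
      ((1 / (2 * Real.pi) : ℂ) * ∫ t : ℝ, (x:ℂ) ^ ((2:ℂ) + t * I) *
        LSeries (fun n => (ArithmeticFunction.vonMangoldt n : ℂ)) (2 + t * I) /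
        ((2 + t * I) * (3 + t * I))) := by
  have hx0 : 0 < x := by linarith
  set F : ℕ → ℝ → ℂ := fun n t => (ArithmeticFunction.vonMangoldt n : ℂ) *
    ((((n / x : ℝ)) : ℂ) ^ (-((2:ℂ) + t * I)) * (1 / ((2 + t * I) * (3 + t * I)))) with hF
  have hFint : ∀ n, Integrable (F n) := by
    intro n
    rcases Nat.eq_zero_or_pos n with rfl | hn
    · simp [hF]
    · have : 0 < (n:ℝ) / x := by positivity
      refine Integrable.const_mul ?_ _
      exact_mod_cast integrable_cpow_line this 2 line2_int
  have hnorm : ∀ n t, ‖F n t‖ = (ArithmeticFunction.vonMangoldt n / (n:ℝ)^2) *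
      (x^2 * ‖1 / (((2:ℂ) + t * I) * ((3:ℂ) + t * I))‖) := by
    intro n t
    rcases Nat.eq_zero_or_pos n with rfl | hn
    · simp [hF]
    · have : 0 < (n:ℝ) / x := by positivity
      simp only [hF]
      rw [norm_mul, norm_mul, norm_cpow_eq_rpow_re_of_pos this, norm_real, Real.norm_eq_abs,
        abs_of_nonneg ArithmeticFunction.vonMangoldt_nonneg]
      have e : (-((2:ℂ) + t * I)).re = -2 := by simp
      have e2 : ((n:ℝ) / x) ^ (-2:ℝ) = x^2 / (n:ℝ)^2 := by
        rw [Real.rpow_neg this.le]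
        norm_cast
        rw [div_pow, inv_div, Nat.cast_pow]
      rw [e, e2]; ring
  have hsumm : Summable (fun n : ℕ => ArithmeticFunction.vonMangoldt n / (n:ℝ)^2) := by
    have h := (ArithmeticFunction.LSeriesSummable_vonMangoldt (s := 2) (by simp)).norm
    refine h.congr ?_
    intro n
    rcases Nat.eq_zero_or_pos n with rfl | hn
    · simp
    · rw [LSeries.norm_term_eq]
      simp [hn.ne', abs_of_nonneg ArithmeticFunction.vonMangoldt_nonneg]
  have hFsum : Summable (fun n => ∫ t, ‖F n t‖) := by
    simp_rw [hnorm, integral_const_mul]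
    exact hsumm.mul_right _
  have hts : ∀ t : ℝ, HasSum (fun n => F n t) ((x:ℂ) ^ ((2:ℂ) + t * I) *
        LSeries (fun n => (ArithmeticFunction.vonMangoldt n : ℂ)) (2 + t * I) /
        ((2 + t * I) * (3 + t * I))) := by
    intro t
    have h := (ArithmeticFunction.LSeriesSummable_vonMangoldt (s := 2 + t * I) (by simp)).hasSum
    have h' := (h.mul_left ((x:ℂ) ^ ((2:ℂ) + t * I))).div_const ((2 + t * I) * (3 + t * I))
    refine h'.congr_fun ?_
    intro n
    rcases Nat.eq_zero_or_pos n with rfl | hn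
    · simp [hF]
    · simp only [hF]
      rw [LSeries.term_of_ne_zero hn.ne']
      have hn0 : (n:ℂ) ≠ 0 := by exact_mod_cast hn.ne'
      have e : (((n / x : ℝ)) : ℂ) ^ (-((2:ℂ) + t * I)) =
          (x:ℂ) ^ ((2:ℂ) + t * I) / (n:ℂ) ^ ((2:ℂ) + t * I) := by
        rw [cpow_neg]
        push_cast
        have := Complex.div_cpow_ofReal_nonneg (a := (n:ℝ)) (b := x) (by positivity) hx0.le ((2:ℂ) + t * I)
        push_cast at this
        rw [this, inv_div]
      rw [e]; ring
  have hint : Integrable (fun t : ℝ => (x:ℂ) ^ ((2:ℂ) + t * I) *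
        LSeries (fun n => (ArithmeticFunction.vonMangoldt n : ℂ)) (2 + t * I) /
        ((2 + t * I) * (3 + t * I))) := by
    refine Integrable.mono' (g := fun t : ℝ =>
      (∑' n : ℕ, ArithmeticFunction.vonMangoldt n / (n:ℝ)^2) *
        (x^2 * ‖1 / (((2:ℂ) + t * I) * ((3:ℂ) + t * I))‖))
      ((line2_int.norm.const_mul _).const_mul _) ?_ ?_
    · refine aestronglyMeasurable_of_tendsto_ae atTop
        (f := fun (N : ℕ) (t : ℝ) => ∑ n ∈ Finset.range N, F n t) ?_ ?_
      · intro N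
        exact (integrable_finsetSum _ (fun n _ => hFint n)).aestronglyMeasurable
      · filter_upwards with t
        exact (hts t).tendsto_sum_nat
    · filter_upwards with t
      rw [← (hts t).tsum_eq]
      exact tsum_of_norm_bounded (hsumm.hasSum.mul_right _) (fun n => (hnorm n t).le)
  have hmain := hasSum_integral_of_summable_integral_norm hFint hFsum
  simp_rw [fun t => (hts t).tsum_eq] at hmain
  refine ⟨hint, ?_⟩
  refine (hmain.mul_left (1 / (2 * Real.pi) : ℂ)).congr_fun ?_
  intro n
  rcases Nat.eq_zero_or_pos n with rfl | hn
  · simp [hF]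
  · have hp : 0 < (n:ℝ) / x := by positivity
    have := kA_inv hp
    simp only [hF]
    rw [integral_const_mul, ← mul_assoc, mul_comm _ (ArithmeticFunction.vonMangoldt n : ℂ), mul_assoc,
      this]
    push_cast; ring

lemma logDeriv_zeta1 {w : ℂ} (hw : 1 < w.re) :
    LSeries (fun n => (ArithmeticFunction.vonMangoldt n : ℂ)) w - 1 / (w - 1) =
      -(deriv riemannZeta₁ w / riemannZeta₁ w) := by
  have h1 := ArithmeticFunction.LSeries_vonMangoldt_eq_deriv_riemannZeta_div hw
  rw [h1]
  have hw1 : w ≠ 1 := by rintro rfl; simp at hw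
  have hw1' : w - 1 ≠ 0 := sub_ne_zero.mpr hw1
  have hz : riemannZeta w ≠ 0 := riemannZeta_ne_zero_of_one_le_re hw.le
  have hd := deriv_riemannZeta_eq_neg_inv_sub_sq_mul_add hw1
  have hz1 := riemannZeta_eq_inv_sub_mul hw1
  have hne : riemannZeta₁ w ≠ 0 := by
    intro h; rw [h, mul_zero] at hz1; exact hz hz1
  rw [hd, hz1]
  field_simp
  ring

lemma explicit_formula {x : ℝ} (hx : 1 < x) :
    HasSum (fun n : ℕ => ((ArithmeticFunction.vonMangoldt n * max (1 - n / x) 0 : ℝ) : ℂ))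
     (((x * (1 - 1/x)^2/2 : ℝ) : ℂ) + (1 / (2 * Real.pi) : ℂ) * ∫ t : ℝ, PhiX x ((2:ℝ) + t * I)) := by
  obtain ⟨hi, hs⟩ := psum_formula hx
  have hx0 : 0 < x := by linarith
  have hxc : (x:ℂ) ≠ 0 := by exact_mod_cast hx0.ne'
  have hB := kB_inv (y := 1/x) (by positivity)
  have hmax : max (1 - 1/x) 0 = 1 - 1/x := by
    apply max_eq_left
    have : 1/x ≤ 1 := by rw [div_le_one hx0]; exact hx.le
    linarith
  rw [hmax] at hB
  have hiB : Integrable (fun t : ℝ => (x:ℂ) * ((((1/x : ℝ)):ℂ) ^ (-(1 + t * I)) *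
      (1 / ((1 + t * I) * (2 + t * I) * (3 + t * I))))) := by
    refine Integrable.const_mul ?_ _
    have h3 := integrable_line3 (σ := 1) (τ := 2) (υ := 3) (by norm_num) (by norm_num) (by norm_num)
    have := integrable_cpow_line (y := 1/x) (by positivity) 1 h3
    exact_mod_cast this
  have e : ∫ t : ℝ, PhiX x ((2:ℝ) + t * I) =
     (∫ t : ℝ, (x:ℂ) ^ ((2:ℂ) + t * I) *
      LSeries (fun n => (ArithmeticFunction.vonMangoldt n : ℂ)) (2 + t * I) /
        ((2 + t * I) * (3 + t * I))) - ∫ t : ℝ, (x:ℂ) * ((((1/x : ℝ)):ℂ) ^ (-(1 + t * I)) *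
      (1 / ((1 + t * I) * (2 + t * I) * (3 + t * I)))) := by
    rw [← integral_sub hi hiB]
    congr 1
    ext t
    have e1 : (x:ℂ) * (((1/x : ℝ)):ℂ) ^ (-(1 + t * I)) = (x:ℂ) ^ ((2:ℂ) + t * I) := by
      rw [cpow_neg]
      have := Complex.div_cpow_ofReal_nonneg (a := (1:ℝ)) (b := x) (by positivity) hx0.le (1 + t * I)
      push_cast at this ⊢
      rw [this, one_cpow, inv_div, div_one]
      have h5 := cpow_add (x := (x:ℂ)) 1 (1 + t * I) hxc
      rw [cpow_one] at h5
      rw [show (2:ℂ) + t * I = 1 + (1 + t * I) by ring, h5]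
    have e2 := logDeriv_zeta1 (w := 2 + t * I) (by simp)
    have e3 : (2:ℂ) + t * I - 1 = 1 + t * I := by ring
    have e4 : (2:ℂ) + t * I + 1 = 3 + t * I := by ring
    rw [e3] at e2
    simp only [PhiX]
    push_cast
    rw [← e2, e4, ← e1]
    push_cast
    have n1 : (1:ℂ) + t * I ≠ 0 := by exact_mod_cast line_ne (σ := 1) (by norm_num)
    have n2 : (2:ℂ) + t * I ≠ 0 := by exact_mod_cast line_ne (σ := 2) (by norm_num)
    have n3 : (3:ℂ) + t * I ≠ 0 := by exact_mod_cast line_ne (σ := 3) (by norm_num)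
    field_simp
  rw [e, mul_sub, integral_const_mul, mul_left_comm, hB]
  convert hs using 1
  push_cast; ring



lemma phi_bound (hRH : RiemannHypothesis) {x : ℝ} (hx : 0 < x) {σ t : ℝ} (h1 : 2/3 ≤ σ) (h2 : σ ≤ 2) :
    ‖PhiX x (σ + t * I)‖ ≤ x ^ σ * (4300 * (1 + ‖t‖) ^ (-(3/2) : ℝ)) := by
  have hb := logDeriv_bound hRH (t := t) h1 h2
  rw [Real.norm_eq_abs]
  set u := 1 + |t| with hu
  have hu1 : 1 ≤ u := by have := abs_nonneg t; linarith
  have hu0 : 0 < u := by linarith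
  have ht2 : t^2 = (u-1)^2 := by rw [hu]; simp
  have hw : u / 2 ≤ ‖(σ:ℂ) + t * I‖ := by
    apply le_of_sq_le_sq _ (norm_nonneg _)
    rw [norm_sq_line, ht2]
    nlinarith [sq_nonneg (u - 4/3)]
  have hw1 : 4/5 * u ≤ ‖(σ:ℂ) + t * I + 1‖ := by
    apply le_of_sq_le_sq _ (norm_nonneg _)
    have := norm_sq_line (σ + 1) t
    push_cast at this
    rw [show (σ:ℂ) + t * I + 1 = σ + 1 + t * I by ring, this, ht2]
    nlinarith [sq_nonneg (u - 25/9)]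
  have hprod : 2/5 * u^2 ≤ ‖(σ:ℂ) + t * I‖ * ‖(σ:ℂ) + t * I + 1‖ := by
    calc 2/5 * u^2 = (u/2) * (4/5*u) := by ring
      _ ≤ _ := by gcongr
  rw [PhiX, norm_div, norm_mul, norm_neg, norm_mul, norm_cpow_eq_rpow_re_of_pos hx]
  have e : ((σ:ℂ) + t * I).re = σ := by simp
  rw [e]
  have e2 : u ^ (-(3/2) : ℝ) = √u / u^2 := by
    rw [Real.sqrt_eq_rpow, ← Real.rpow_natCast, ← Real.rpow_sub hu0]; norm_num
  rw [e2, mul_div_assoc]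
  have hxp : 0 < x ^ σ := Real.rpow_pos_of_pos hx _
  gcongr
  calc _ ≤ (1720 * √u) / (2/5 * u^2) := by gcongr
    _ = _ := by field_simp; norm_num

lemma kern_integrable : Integrable (fun t : ℝ => (1 + ‖t‖) ^ (-(3/2) : ℝ)) :=
  integrable_one_add_norm (by simp; norm_num)

lemma kern_integral : ∫ t : ℝ, (1 + ‖t‖) ^ (-(3/2) : ℝ) = 4 := by
  simp_rw [Real.norm_eq_abs]
  rw [integral_comp_abs (f := fun t => (1 + t) ^ (-(3/2) : ℝ))]
  have h := (measurePreserving_add_left volume (1:ℝ)).setIntegral_preimage_emb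
    (MeasurableEquiv.addLeft (1:ℝ)).measurableEmbedding (fun t : ℝ => t ^ (-(3/2) : ℝ)) (Ioi 1)
  rw [integral_Ioi_rpow_of_lt (by norm_num) (by norm_num)] at h
  have e : (fun t : ℝ => 1 + t) ⁻¹' Ioi 1 = Ioi 0 := by ext; simp
  rw [e] at h
  rw [h]; norm_num

lemma phi_diff (hRH : RiemannHypothesis) {x : ℝ} (hx : 0 < x) {w : ℂ} (hw : 1/2 < w.re) :
    DifferentiableAt ℂ (PhiX x) w := by
  have hxc : (x:ℂ) ≠ 0 := by exact_mod_cast hx.ne'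
  have hd : DifferentiableAt ℂ (deriv riemannZeta₁) w :=
    ((differentiable_riemannZeta₁.differentiableOn (s := univ)).deriv isOpen_univ).differentiableAt
      univ_mem
  have hz := zeta1_ne hRH hw
  have hw0 : w ≠ 0 := by rintro rfl; norm_num at hw
  have hw1 : w + 1 ≠ 0 := by
    intro h
    have := congrArg re h
    simp at this
    linarith
  unfold PhiX
  refine DifferentiableAt.div (DifferentiableAt.mul ?_ (DifferentiableAt.neg
    (hd.div differentiable_riemannZeta₁.differentiableAt hz))) (by fun_prop) (mul_ne_zero hw0 hw1)
  exact DifferentiableAt.const_cpow differentiableAt_id (Or.inl hxc)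

lemma phi_integrable (hRH : RiemannHypothesis) {x : ℝ} (hx : 0 < x) {σ : ℝ} (h1 : 2/3 ≤ σ) (h2 : σ ≤ 2) :
    Integrable (fun t : ℝ => PhiX x (σ + t * I)) := by
  refine Integrable.mono' ((kern_integrable.const_mul 4300).const_mul (x ^ σ)) ?_ ?_
  · apply Continuous.aestronglyMeasurable
    rw [continuous_iff_continuousAt]
    intro t
    have hc := (phi_diff hRH hx (w := σ + t * I) (by simp; linarith)).continuousAt
    exact ContinuousAt.comp (f := fun t : ℝ => (σ:ℂ) + t * I) hc (by fun_prop)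
  · filter_upwards with t
    exact phi_bound hRH hx h1 h2

lemma contour_shift (hRH : RiemannHypothesis) {x : ℝ} (hx : 1 < x) :
    ∫ t : ℝ, PhiX x ((2:ℝ) + t * I) = ∫ t : ℝ, PhiX x ((2/3:ℝ) + t * I) := by
  have hx0 : 0 < x := by linarith
  have hrect : ∀ T : ℝ, ((∫ y in (2/3:ℝ)..2, PhiX x (y + ((-T : ℝ):ℂ) * I)) -
      (∫ y in (2/3:ℝ)..2, PhiX x (y + (T:ℂ) * I)) +
      I • ∫ t in (-T)..T, PhiX x ((2:ℝ) + t * I)) -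
      I • ∫ t in (-T)..T, PhiX x ((2/3:ℝ) + t * I) = 0 := by
    intro T
    have := Complex.integral_boundary_rect_eq_zero_of_differentiableOn (PhiX x)
      ⟨2/3, -T⟩ ⟨2, T⟩ (by
        intro w hw
        rw [mem_reProdIm] at hw
        have h := hw.1
        simp only [] at h
        rw [uIcc_of_le (by norm_num)] at h
        exact (phi_diff hRH hx0 (by linarith [h.1])).differentiableWithinAt)
    exact this
  have hv := intervalIntegral_tendsto_integral (phi_integrable hRH hx0 (σ := 2) (by norm_num) le_rfl)
    tendsto_neg_atTop_atBot tendsto_id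
  have hv' := intervalIntegral_tendsto_integral
    (phi_integrable hRH hx0 (σ := 2/3) le_rfl (by norm_num))
    tendsto_neg_atTop_atBot tendsto_id
  have hhor : ∀ T : ℝ, ‖∫ y in (2/3:ℝ)..2, PhiX x (y + (T:ℂ) * I)‖ ≤
      x^2 * (4300 * (1 + ‖T‖) ^ (-(3/2) : ℝ)) * |2 - 2/3| := by
    intro T
    apply intervalIntegral.norm_integral_le_of_norm_le_const
    intro y hy
    rw [uIoc_of_le (by norm_num)] at hy
    refine (phi_bound hRH hx0 hy.1.le hy.2).trans ?_
    gcongr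
    rw [← Real.rpow_natCast]
    exact Real.rpow_le_rpow_of_exponent_le hx.le (by simpa using hy.2)
  have hk : Tendsto (fun T : ℝ => x^2 * (4300 * (1 + ‖T‖) ^ (-(3/2) : ℝ)) * |2 - 2/3|) atTop (𝓝 0) := by
    have h1 : Tendsto (fun T : ℝ => (1 + ‖T‖)) atTop atTop :=
      tendsto_atTop_add_const_left _ _ tendsto_norm_atTop_atTop
    have h2 := (tendsto_rpow_neg_atTop (y := 3/2) (by norm_num)).comp h1
    have h3 := ((h2.const_mul 4300).const_mul (x^2)).mul_const |(2:ℝ) - 2/3|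
    simpa using h3
  have hp : Tendsto (fun T : ℝ => ∫ y in (2/3:ℝ)..2, PhiX x (y + (T:ℂ) * I)) atTop (𝓝 0) :=
    squeeze_zero_norm hhor hk
  have hm : Tendsto (fun T : ℝ => ∫ y in (2/3:ℝ)..2, PhiX x (y + ((-T : ℝ):ℂ) * I)) atTop (𝓝 0) := by
    refine squeeze_zero_norm (fun T => ?_) hk
    have := hhor (-T)
    rwa [norm_neg T] at this
  have hlim := ((hm.sub hp).add (hv.const_smul I)).sub (hv'.const_smul I)
  have h0 : Tendsto (fun _ : ℝ => (0:ℂ)) atTop (𝓝 0) := tendsto_const_nhds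
  have huniq := tendsto_nhds_unique (hlim.congr (fun T => hrect T)) h0
  simp only [sub_self, zero_add, smul_eq_mul] at huniq
  rw [← mul_sub] at huniq
  exact sub_eq_zero.mp ((mul_eq_zero.mp huniq).resolve_left I_ne_zero)

lemma smooth_bound (hRH : RiemannHypothesis) {x : ℝ} (hx : 1 < x) :
    ∃ S : ℝ, HasSum (fun n : ℕ => ArithmeticFunction.vonMangoldt n * max (1 - n / x) 0) S ∧
      |S - x * (1 - 1/x)^2/2| ≤ 2800 * x ^ (2/3 : ℝ) := by
  have hx0 : 0 < x := by linarith
  have h := explicit_formula hx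
  rw [contour_shift hRH hx] at h
  set J := ∫ t : ℝ, PhiX x ((2/3:ℝ) + t * I) with hJ
  have hJb : ‖J‖ ≤ x ^ (2/3:ℝ) * (4300 * 4) := by
    refine (norm_integral_le_of_norm_le ((kern_integrable.const_mul 4300).const_mul (x ^ (2/3:ℝ)))
      (Eventually.of_forall fun t => phi_bound hRH hx0 le_rfl (by norm_num))).trans ?_
    rw [integral_const_mul, integral_const_mul, kern_integral]
  have hre := Complex.hasSum_re h
  simp only [ofReal_re] at hre
  refine ⟨_, hre, ?_⟩
  rw [add_re, ofReal_re, add_sub_cancel_left]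
  refine (abs_re_le_norm _).trans ?_
  rw [norm_mul]
  have hpi : ‖(1 / (2 * Real.pi) : ℂ)‖ = 1 / (2 * Real.pi) := by
    have := norm_real (1 / (2 * Real.pi))
    push_cast at this
    rw [this, Real.norm_of_nonneg (by positivity)]
  rw [hpi]
  have hp3 := Real.pi_gt_d2
  have hxp : 0 < x ^ (2/3:ℝ) := Real.rpow_pos_of_pos hx0 _
  calc _ ≤ 1 / (2 * Real.pi) * (x ^ (2/3:ℝ) * (4300 * 4)) := by gcongr
    _ ≤ 1 / (2 * 3.14) * (x ^ (2/3:ℝ) * (4300 * 4)) := by gcongr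
    _ ≤ _ := by nlinarith



lemma smooth_fin (hRH : RiemannHypothesis) {x : ℝ} (hx : 1 < x) {N : ℕ} (hN : x ≤ N) :
    |∑ n ∈ Finset.range N, ArithmeticFunction.vonMangoldt n * max (x - n) 0 - (x - 1)^2/2| ≤
      2800 * x ^ (5/3 : ℝ) := by
  obtain ⟨S, hS, hb⟩ := smooth_bound hRH hx
  have hx0 : 0 < x := by linarith
  have hfin : HasSum (fun n : ℕ => ArithmeticFunction.vonMangoldt n * max (1 - n / x) 0)
      (∑ n ∈ Finset.range N, ArithmeticFunction.vonMangoldt n * max (1 - n / x) 0) := by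
    apply hasSum_sum_of_ne_finset_zero
    intro n hn
    have h1 : N ≤ n := by simpa using hn
    have h2 : x ≤ n := hN.trans (by exact_mod_cast h1)
    have h3 : 1 ≤ n / x := by rw [le_div_iff₀ hx0]; linarith
    rw [max_eq_right (by linarith), mul_zero]
  have hSe := hS.unique hfin
  have e : ∑ n ∈ Finset.range N, ArithmeticFunction.vonMangoldt n * max (x - n) 0 = x * S := by
    rw [hSe, Finset.mul_sum]
    refine Finset.sum_congr rfl fun n _ => ?_
    have : max (x - n) 0 = x * max (1 - n / x) 0 := by
      rw [mul_max_of_nonneg _ _ hx0.le]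
      congr 1
      · field_simp
      · ring
    rw [this]; ring
  rw [e]
  have e2 : x * S - (x - 1)^2/2 = x * (S - x * (1 - 1/x)^2/2) := by field_simp
  rw [e2, abs_mul, abs_of_pos hx0]
  have e3 : x ^ (5/3:ℝ) = x * x ^ (2/3:ℝ) := by
    rw [show (5/3:ℝ) = 1 + 2/3 by norm_num, Real.rpow_add hx0, Real.rpow_one]
  rw [e3]
  nlinarith [mul_le_mul_of_nonneg_left hb hx0.le]

lemma psi_range {x : ℝ} {N : ℕ} (hx : 0 ≤ x) (hN : x < N) :
    Chebyshev.psi x = ∑ n ∈ Finset.range N, if (n:ℝ) ≤ x then ArithmeticFunction.vonMangoldt n else 0 := by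
  rw [Chebyshev.psi_eq_sum_Icc, ← Finset.sum_filter]
  apply Finset.sum_congr _ fun _ _ => rfl
  ext n
  simp only [Finset.mem_Icc, zero_le, true_and, Finset.mem_filter, Finset.mem_range]
  rw [Nat.le_floor_iff hx]
  constructor
  · intro h
    exact ⟨by exact_mod_cast h.trans_lt hN, h⟩
  · exact fun h => h.2

lemma psi_diff_up {x y : ℝ} {N : ℕ} (hx : 0 ≤ x) (hxy : x ≤ y) (hN : y < N) :
    (y - x) * Chebyshev.psi x ≤ ∑ n ∈ Finset.range N, ArithmeticFunction.vonMangoldt n * max (y - n) 0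
      - ∑ n ∈ Finset.range N, ArithmeticFunction.vonMangoldt n * max (x - n) 0 := by
  rw [psi_range hx (hxy.trans_lt hN), Finset.mul_sum, ← Finset.sum_sub_distrib]
  refine Finset.sum_le_sum fun n _ => ?_
  have hL : 0 ≤ ArithmeticFunction.vonMangoldt n := ArithmeticFunction.vonMangoldt_nonneg
  split_ifs with h
  · rw [max_eq_left (by linarith), max_eq_left (by linarith)]
    apply le_of_eq; ring
  · rw [max_eq_right (b := (0:ℝ)) (a := x - n) (by linarith)]
    have := le_max_right (y - n) 0
    nlinarith [mul_nonneg hL this]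

lemma psi_diff_down {x y : ℝ} {N : ℕ} (hx : 0 ≤ x) (hxy : y ≤ x) (hN : x < N) :
    ∑ n ∈ Finset.range N, ArithmeticFunction.vonMangoldt n * max (x - n) 0
      - ∑ n ∈ Finset.range N, ArithmeticFunction.vonMangoldt n * max (y - n) 0 ≤
      (x - y) * Chebyshev.psi x := by
  rw [psi_range hx hN, Finset.mul_sum, ← Finset.sum_sub_distrib]
  refine Finset.sum_le_sum fun n _ => ?_
  have hL : 0 ≤ ArithmeticFunction.vonMangoldt n := ArithmeticFunction.vonMangoldt_nonneg
  split_ifs with h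
  · rw [max_eq_left (a := x - n) (by linarith)]
    have := le_max_left (y - n) 0
    nlinarith [mul_le_mul_of_nonneg_left this hL]
  · rw [max_eq_right (a := x - n) (by linarith), max_eq_right (a := y - n) (by linarith)]
    simp

lemma exp_cube_bound {L : ℝ} (hL : 45 ≤ L) : 520 * L^2 ≤ Real.exp (L/3) := by
  set v := L/3 - 15 with hv
  have hv0 : 0 ≤ v := by rw [hv]; linarith
  have e : Real.exp (L/3) = Real.exp 15 * Real.exp v := by
    rw [← Real.exp_add]; congr 1; rw [hv]; ring
  have h15 : (2900000:ℝ) ≤ Real.exp 15 := by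
    have := Real.exp_one_gt_d9
    calc (2900000:ℝ) ≤ 2.7182818283 ^ 15 := by norm_num
      _ ≤ (Real.exp 1)^15 := by gcongr
      _ = Real.exp 15 := by rw [← Real.exp_nat_mul]; norm_num
  have hq := Real.quadratic_le_exp_of_nonneg hv0
  have hLv : L = 3 * v + 45 := by rw [hv]; ring
  rw [e, hLv]
  calc 520 * (3 * v + 45)^2 ≤ 2900000 * (1 + v + v^2/2) := by nlinarith [sq_nonneg v]
    _ ≤ _ := by gcongr

lemma psi_large (hRH : RiemannHypothesis) {x : ℝ} (hx : 0 < x) (hL : 45 ≤ Real.log x) :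
    |Chebyshev.psi x - x| ≤ 5 * x / Real.log x := by
  set L := Real.log x with hLdef
  have hL0 : 0 < L := by linarith
  have hxe : x = Real.exp L := (Real.exp_log hx).symm
  have hx46 : 46 ≤ x := by rw [hxe]; linarith [Real.add_one_le_exp L]
  set c := Real.exp (L/3) with hc
  have hcL : 520 * L^2 ≤ c := exp_cube_bound hL
  have hc0 : 0 < c := Real.exp_pos _
  have hx53 : x ^ (5/3:ℝ) = x^2 / c := by
    rw [Real.rpow_def_of_pos hx, ← hLdef, hc, eq_div_iff (Real.exp_pos _).ne', ← Real.exp_add, hxe,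
      ← Real.exp_nat_mul]
    congr 1; push_cast; ring
  set d := 4 * x / L with hd
  have hd0 : 0 < d := by positivity
  have hdx : d ≤ 0.09 * x := by
    rw [hd, div_le_iff₀ hL0]; nlinarith
  have hxd : 4 * x = d * L := by rw [hd]; field_simp
  obtain ⟨N, hN⟩ := exists_nat_gt (x + d)
  have p1 := smooth_fin hRH (x := x) (by linarith) (N := N) (by linarith)
  have p2 := smooth_fin hRH (x := x + d) (by linarith) (N := N) (by linarith)
  have p3 := smooth_fin hRH (x := x - d) (by linarith) (N := N) (by linarith)
  have u1 := psi_diff_up (x := x) (y := x + d) hx.le (by linarith) hN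
  have u2 := psi_diff_down (x := x) (y := x - d) hx.le (by linarith) (N := N) (by linarith)
  have q2 : (x + d) ^ (5/3:ℝ) ≤ 1.19 * (x^2 / c) := by
    calc (x + d) ^ (5/3:ℝ) ≤ (1.09 * x) ^ (5/3:ℝ) := by
          apply Real.rpow_le_rpow (by linarith) (by linarith) (by norm_num)
      _ = 1.09 ^ (5/3:ℝ) * x ^ (5/3:ℝ) := Real.mul_rpow (by norm_num) hx.le
      _ ≤ 1.19 * (x^2 / c) := by
          rw [hx53]
          gcongr
          calc (1.09:ℝ) ^ (5/3:ℝ) ≤ (1.09:ℝ) ^ (2:ℝ) :=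
                Real.rpow_le_rpow_of_exponent_le (by norm_num) (by norm_num)
            _ ≤ 1.19 := by norm_num
  have q3 : (x - d) ^ (5/3:ℝ) ≤ x^2 / c := by
    rw [← hx53]
    exact Real.rpow_le_rpow (by linarith) (by linarith) (by norm_num)
  rw [hx53] at p1
  set W := x^2 / c with hW
  -- x²/c ≤ x²/(520 L²) = d² / (520 * 16)
  have hWd : W ≤ d^2 / 8320 := by
    rw [hW, div_le_div_iff₀ hc0 (by norm_num)]
    have : d^2 * L^2 = 16 * x^2 := by rw [← mul_pow, ← hxd]; ring
    nlinarith [mul_le_mul_of_nonneg_left hcL (sq_nonneg d)]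
  rw [abs_le] at p1 p2 p3
  have hd1 : 15 ≤ d := by
    have := Real.quadratic_le_exp_of_nonneg hL0.le
    rw [← hxe] at this
    rw [hd, le_div_iff₀ hL0]
    nlinarith
  have hdd : 15 * d ≤ d^2 := by nlinarith
  have hfin : 5 * x / L = 5/4 * d := by rw [hd]; ring
  rw [hfin, abs_le]
  rw [show x + d - x = d by ring] at u1
  rw [show x - (x - d) = d by ring] at u2
  generalize (∑ n ∈ Finset.range N, ArithmeticFunction.vonMangoldt n * max (x - n) 0) = A1 at *
  generalize (∑ n ∈ Finset.range N, ArithmeticFunction.vonMangoldt n * max (x + d - n) 0) = A2 at *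
  generalize (∑ n ∈ Finset.range N, ArithmeticFunction.vonMangoldt n * max (x - d - n) 0) = A3 at *
  generalize Chebyshev.psi x = p at *
  obtain ⟨p1a, p1b⟩ := p1
  obtain ⟨p2a, p2b⟩ := p2
  obtain ⟨p3a, p3b⟩ := p3
  have i2 : (x + d - 1)^2 = (x-1)^2 + 2 * d * x - 2 * d + d^2 := by ring
  have i3 : (x - d - 1)^2 = (x-1)^2 - 2 * d * x + 2 * d + d^2 := by ring
  rw [i2] at p2a p2b
  rw [i3] at p3a p3b
  constructor
  · have : d * (x - 5/4*d) ≤ d * p := by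
      rw [show d * (x - 5/4*d) = d * x - 5/4 * d^2 by ring]
      linarith
    have := le_of_mul_le_mul_left this hd0
    linarith
  · have : d * p ≤ d * (x + 5/4*d) := by
      rw [show d * (x + 5/4*d) = d * x + 5/4 * d^2 by ring]
      linarith
    have := le_of_mul_le_mul_left this hd0
    linarith



lemma log_fact_eq (N m : ℕ) (hm : m ≤ N) :
    Real.log (m.factorial) = ∑ d ∈ Finset.Ioc 0 N, ArithmeticFunction.vonMangoldt d * ((m / d : ℕ) : ℝ) := by
  induction m with
  | zero => simp
  | succ m ih =>
    have h1 := ih (by omega)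
    rw [Nat.factorial_succ, Nat.cast_mul, Real.log_mul (by positivity) (by positivity), h1,
      ← ArithmeticFunction.vonMangoldt_sum]
    have e : ∀ d ∈ Finset.Ioc 0 N, ArithmeticFunction.vonMangoldt d * (((m + 1) / d : ℕ) : ℝ) =
        (if d ∣ m + 1 then ArithmeticFunction.vonMangoldt d else 0) +
        ArithmeticFunction.vonMangoldt d * ((m / d : ℕ) : ℝ) := by
      intro d _
      rw [Nat.succ_div]
      split_ifs <;> push_cast <;> ring
    rw [Finset.sum_congr rfl e, Finset.sum_add_distrib, ← Finset.sum_filter]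
    congr 1
    apply Finset.sum_congr _ fun _ _ => rfl
    ext d
    simp only [Nat.mem_divisors, Finset.mem_filter, Finset.mem_Ioc]
    constructor
    · rintro ⟨h, _⟩
      exact ⟨⟨Nat.pos_of_dvd_of_pos h (by omega), (Nat.le_of_dvd (by omega) h).trans hm⟩, h⟩
    · exact fun h => ⟨h.2, by omega⟩

lemma cheb_coef (q : ℕ) : q / 2 + q / 3 + q / 5 ≤ q + q / 30 ∧ q + q / 30 ≤ q / 2 + q / 3 + q / 5 + 1 ∧
    (1 ≤ q → q < 6 → q + q / 30 = q / 2 + q / 3 + q / 5 + 1) := by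
  refine ⟨by omega, by omega, by omega⟩

/-- Chebyshev's combination of factorial logarithms. -/
noncomputable def chebD (n : ℕ) : ℝ :=
  Real.log (n.factorial) - Real.log ((n/2).factorial) - Real.log ((n/3).factorial)
    - Real.log ((n/5).factorial) + Real.log ((n/30).factorial)

lemma chebD_eq (n : ℕ) : chebD n = ∑ d ∈ Finset.Ioc 0 n, ArithmeticFunction.vonMangoldt d *
    (((n / d : ℕ) : ℝ) - ((n / d / 2 : ℕ) : ℝ) - ((n / d / 3 : ℕ) : ℝ) - ((n / d / 5 : ℕ) : ℝ) +
      ((n / d / 30 : ℕ) : ℝ)) := by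
  unfold chebD
  rw [log_fact_eq n n le_rfl, log_fact_eq n (n/2) (Nat.div_le_self _ _),
    log_fact_eq n (n/3) (Nat.div_le_self _ _), log_fact_eq n (n/5) (Nat.div_le_self _ _),
    log_fact_eq n (n/30) (Nat.div_le_self _ _), ← Finset.sum_sub_distrib, ← Finset.sum_sub_distrib,
    ← Finset.sum_sub_distrib, ← Finset.sum_add_distrib]
  refine Finset.sum_congr rfl fun d _ => ?_
  rw [Nat.div_right_comm n 2 d, Nat.div_right_comm n 3 d, Nat.div_right_comm n 5 d,
    Nat.div_right_comm n 30 d]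
  ring

lemma chebD_le (n : ℕ) : chebD n ≤ Chebyshev.psi n := by
  rw [chebD_eq, Chebyshev.psi, Nat.floor_natCast]
  refine Finset.sum_le_sum fun d _ => ?_
  have hL : 0 ≤ ArithmeticFunction.vonMangoldt d := ArithmeticFunction.vonMangoldt_nonneg
  have h := (cheb_coef (n / d)).2.1
  have h' : ((n / d : ℕ) : ℝ) + ((n / d / 30 : ℕ) : ℝ) ≤
    ((n / d / 2 : ℕ) : ℝ) + ((n / d / 3 : ℕ) : ℝ) + ((n / d / 5 : ℕ) : ℝ) + 1 := by exact_mod_cast h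
  nlinarith

lemma chebD_ge (n : ℕ) : Chebyshev.psi n - Chebyshev.psi (n / 6 : ℕ) ≤ chebD n := by
  rw [chebD_eq, Chebyshev.psi, Nat.floor_natCast, Chebyshev.psi, Nat.floor_natCast]
  have hsub : Finset.Ioc 0 (n/6) ⊆ Finset.Ioc 0 n := Finset.Ioc_subset_Ioc_right (Nat.div_le_self _ _)
  rw [← Finset.sum_sdiff hsub, add_sub_cancel_right, ← Finset.sum_sdiff hsub]
  have hL : ∀ d, 0 ≤ ArithmeticFunction.vonMangoldt d := fun _ => ArithmeticFunction.vonMangoldt_nonneg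
  have hnn : ∀ d, 0 ≤ (((n / d : ℕ) : ℝ) - ((n / d / 2 : ℕ) : ℝ) - ((n / d / 3 : ℕ) : ℝ) - ((n / d / 5 : ℕ) : ℝ) +
      ((n / d / 30 : ℕ) : ℝ)) := by
    intro d
    have h' : ((n / d / 2 : ℕ) : ℝ) + ((n / d / 3 : ℕ) : ℝ) + ((n / d / 5 : ℕ) : ℝ) ≤
      ((n / d : ℕ) : ℝ) + ((n / d / 30 : ℕ) : ℝ) := by exact_mod_cast (cheb_coef (n / d)).1
    linarith
  refine le_add_of_le_of_nonneg (Finset.sum_le_sum fun d hd => ?_)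
    (Finset.sum_nonneg fun d _ => mul_nonneg (hL d) (hnn d))
  simp only [Finset.mem_sdiff, Finset.mem_Ioc, not_and, not_le] at hd
  have h1 : 1 ≤ n / d := (Nat.one_le_div_iff hd.1.1).mpr hd.1.2
  have h2 : n / d < 6 := by
    have := hd.2 hd.1.1
    rw [Nat.div_lt_iff_lt_mul (by omega)] at this ⊢
    linarith
  have h := (cheb_coef (n / d)).2.2 h1 h2
  have h' : ((n / d : ℕ) : ℝ) + ((n / d / 30 : ℕ) : ℝ) =
    ((n / d / 2 : ℕ) : ℝ) + ((n / d / 3 : ℕ) : ℝ) + ((n / d / 5 : ℕ) : ℝ) + 1 := by exact_mod_cast h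
  have : (((n / d : ℕ) : ℝ) - ((n / d / 2 : ℕ) : ℝ) - ((n / d / 3 : ℕ) : ℝ) - ((n / d / 5 : ℕ) : ℝ) +
      ((n / d / 30 : ℕ) : ℝ)) = 1 := by linarith
  rw [this, mul_one]

lemma log_fact_nat (m : ℕ) (hm : 1 ≤ m) :
    (m:ℝ) * Real.log m - m + 1 ≤ Real.log m.factorial ∧
      Real.log m.factorial ≤ (m:ℝ) * Real.log m - m + 1 + Real.log m := by
  induction m, hm using Nat.le_induction with
  | base => simp
  | succ m hm ih =>
    have hm0 : (0:ℝ) < m := by exact_mod_cast hm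
    rw [Nat.factorial_succ, Nat.cast_mul, Real.log_mul (by positivity) (by positivity)]
    push_cast
    have a1 : Real.log (((m:ℝ) + 1) / m) ≤ ((m:ℝ) + 1) / m - 1 := Real.log_le_sub_one_of_pos (by positivity)
    have a2 : 1 - (((m:ℝ) + 1) / m)⁻¹ ≤ Real.log (((m:ℝ) + 1) / m) :=
      Real.one_sub_inv_le_log_of_pos (by positivity)
    rw [Real.log_div (by positivity) hm0.ne'] at a1 a2
    have b1 : m * (Real.log (m+1) - Real.log m) ≤ 1 := by
      calc _ ≤ m * (((m:ℝ) + 1) / m - 1) := by gcongr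
        _ = 1 := by field_simp; ring
    have b2 : 1 ≤ ((m:ℝ) + 1) * (Real.log (m+1) - Real.log m) := by
      calc 1 = ((m:ℝ) + 1) * (1 - (((m:ℝ) + 1) / m)⁻¹) := by field_simp; ring
        _ ≤ _ := by gcongr
    constructor <;> nlinarith [ih.1, ih.2]

lemma log_fact_div (n k : ℕ) (hk : 1 ≤ k) (hn : k ≤ n) :
    |Real.log ((n / k).factorial) - ((n:ℝ) / k * Real.log (n / k) - n / k + 1)| ≤ Real.log n := by
  set m := n / k with hm
  have hm1 : 1 ≤ m := (Nat.one_le_div_iff (by omega)).mpr hn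
  have hm0 : (0:ℝ) < m := by exact_mod_cast hm1
  have hk0 : (0:ℝ) < k := by exact_mod_cast hk
  set y : ℝ := (n:ℝ) / k with hy
  have hmy : (m:ℝ) ≤ y := Nat.cast_div_le
  have hym : y < m + 1 := by
    rw [hy, div_lt_iff₀ hk0]
    have := Nat.lt_div_mul_add (a := n) (b := k) (by omega)
    have h2 : n < (m + 1) * k := by rw [hm]; linarith
    exact_mod_cast h2
  have hy0 : 0 < y := by linarith
  have hm1' : (1:ℝ) ≤ m := by exact_mod_cast hm1
  have hyn : y ≤ n := by
    rw [hy]; exact div_le_self (by positivity) (by exact_mod_cast hk)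
  have hly : Real.log y ≤ Real.log n := Real.log_le_log hy0 hyn
  obtain ⟨l1, l2⟩ := log_fact_nat m hm1
  have c1 : Real.log (y / m) ≤ y / m - 1 := Real.log_le_sub_one_of_pos (by positivity)
  have c2 : Real.log (m / y) ≤ m / y - 1 := Real.log_le_sub_one_of_pos (by positivity)
  rw [Real.log_div (by positivity) (by positivity)] at c1 c2
  have d1 : m * (Real.log y - Real.log m) ≤ y - m := by
    calc _ ≤ m * (y / m - 1) := by gcongr
      _ = _ := by field_simp
  have d2 : y * (Real.log m - Real.log y) ≤ m - y := by
    calc _ ≤ y * (m / y - 1) := by gcongr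
      _ = _ := by field_simp
  have hlm : 0 ≤ Real.log m := Real.log_nonneg hm1'
  have hlmy : Real.log m ≤ Real.log y := Real.log_le_log hm0 hmy
  rw [abs_le]
  constructor
  · nlinarith
  · nlinarith

lemma chebD_approx (n : ℕ) (hn : 30 ≤ n) :
    |chebD n - (n * (14/30 * Real.log 2 + 9/30 * Real.log 3 + 5/30 * Real.log 5) - 1)| ≤ 5 * Real.log n := by
  have h1 := log_fact_div n 1 le_rfl (by omega)
  have h2 := log_fact_div n 2 (by omega) (by omega)
  have h3 := log_fact_div n 3 (by omega) (by omega)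
  have h5 := log_fact_div n 5 (by omega) (by omega)
  have h30 := log_fact_div n 30 (by omega) (by omega)
  have hn0 : (n:ℝ) ≠ 0 := by positivity
  have e30 : Real.log 30 = Real.log 2 + Real.log 3 + Real.log 5 := by
    rw [← Real.log_mul (by norm_num) (by norm_num), ← Real.log_mul (by norm_num) (by norm_num)]
    norm_num
  push_cast at h1 h2 h3 h5 h30
  rw [Nat.div_one, div_one] at h1
  rw [Real.log_div hn0 (by norm_num)] at h2 h3 h5 h30
  rw [e30] at h30
  unfold chebD
  rw [abs_le] at *
  obtain ⟨h1a, h1b⟩ := h1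
  obtain ⟨h2a, h2b⟩ := h2
  obtain ⟨h3a, h3b⟩ := h3
  obtain ⟨h5a, h5b⟩ := h5
  obtain ⟨h30a, h30b⟩ := h30
  constructor <;> linarith

lemma log_pow_le {a b k l : ℕ} (ha : 0 < a) (h : a ^ k ≤ b ^ l) : k * Real.log a ≤ l * Real.log b := by
  rw [← Real.log_pow, ← Real.log_pow]
  exact Real.log_le_log (by positivity) (by exact_mod_cast h)

lemma cheb_const : 0.92 ≤ 14/30 * Real.log 2 + 9/30 * Real.log 3 + 5/30 * Real.log 5 ∧
    14/30 * Real.log 2 + 9/30 * Real.log 3 + 5/30 * Real.log 5 ≤ 0.9216 := by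
  have a := Real.log_two_gt_d9
  have b := Real.log_two_lt_d9
  have c1 := log_pow_le (a := 2) (b := 3) (k := 19) (l := 12) (by norm_num) (by norm_num)
  have c2 := log_pow_le (a := 3) (b := 2) (k := 41) (l := 65) (by norm_num) (by norm_num)
  have c3 := log_pow_le (a := 2) (b := 5) (k := 65) (l := 28) (by norm_num) (by norm_num)
  have c4 := log_pow_le (a := 5) (b := 2) (k := 31) (l := 72) (by norm_num) (by norm_num)
  push_cast at c1 c2 c3 c4
  constructor <;> linarith

lemma psi_step (n : ℕ) (hn : 30 ≤ n) :
    Chebyshev.psi n ≤ Chebyshev.psi (n / 6 : ℕ) + 0.9216 * n + 5 * Real.log n := by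
  have h1 := chebD_ge n
  have h2 := (abs_le.mp (chebD_approx n hn)).2
  have h3 := mul_le_mul_of_nonneg_left cheb_const.2 (Nat.cast_nonneg (α := ℝ) n)
  linarith

lemma psi_lower (n : ℕ) (hn : 30 ≤ n) : 0.92 * n - 1 - 5 * Real.log n ≤ Chebyshev.psi n := by
  have h1 := chebD_le n
  have h2 := (abs_le.mp (chebD_approx n hn)).1
  have h3 := mul_le_mul_of_nonneg_left cheb_const.1 (Nat.cast_nonneg (α := ℝ) n)
  linarith

lemma psi_upper_nat (n : ℕ) (hn : 200000 ≤ n) :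
    Chebyshev.psi n ≤ 1.1094 * n + 20 * Real.log n := by
  have hmono : ∀ m : ℕ, 1 ≤ m → m ≤ n → Real.log m ≤ Real.log n := fun m h1 h2 =>
    Real.log_le_log (by exact_mod_cast h1) (by exact_mod_cast h2)
  have h1 := psi_step n (by omega)
  have h2 := psi_step (n/6) (by omega)
  have h3 := psi_step (n/6/6) (by omega)
  have h4 := psi_step (n/6/6/6) (by omega)
  have l2 := hmono (n/6) (by omega) (by omega)
  have l3 := hmono (n/6/6) (by omega) (by omega)
  have l4 := hmono (n/6/6/6) (by omega) (by omega)
  have h5 := Chebyshev.psi_le_const_mul_self (x := ((n/6/6/6/6 : ℕ):ℝ)) (by positivity)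
  have hl4 : Real.log 4 ≤ 1.4 := by
    have b := Real.log_two_lt_d9
    rw [show (4:ℝ) = 2^2 by norm_num, Real.log_pow]; push_cast; linarith
  have q1 : ((n/6 : ℕ):ℝ) ≤ n/6 := Nat.cast_div_le
  have q2 : ((n/6/6 : ℕ):ℝ) ≤ ((n/6 : ℕ):ℝ)/6 := Nat.cast_div_le
  have q3 : ((n/6/6/6 : ℕ):ℝ) ≤ ((n/6/6 : ℕ):ℝ)/6 := Nat.cast_div_le
  have q4 : ((n/6/6/6/6 : ℕ):ℝ) ≤ ((n/6/6/6 : ℕ):ℝ)/6 := Nat.cast_div_le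
  have h6 : (Real.log 4 + 4) * ((n/6/6/6/6 : ℕ):ℝ) ≤ 5.4 * ((n/6/6/6/6 : ℕ):ℝ) := by
    gcongr; linarith
  linarith

lemma cheb_psi {x : ℝ} (hx : 0 < x) (hL : 12.4 ≤ Real.log x) :
    0.91 * x ≤ Chebyshev.psi x ∧ (13.5 ≤ Real.log x → Chebyshev.psi x ≤ 1.11 * x) := by
  set L := Real.log x with hLdef
  have hxe : x = Real.exp L := (Real.exp_log hx).symm
  -- x ≥ e^12.4 * (1 + (L - 12.4))
  have hbig : 240000 * (L - 11.4) ≤ x := by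
    have h12 : (240000:ℝ) ≤ Real.exp 12.4 := by
      have h4 : Real.exp 12.4 ^ 5 = Real.exp 1 ^ 62 := by
        rw [← Real.exp_nat_mul, ← Real.exp_nat_mul]; norm_num
      by_contra hc
      push Not at hc
      have : Real.exp 12.4 ^ 5 ≤ 240000^5 := by gcongr
      have h2 : (2.718:ℝ)^62 ≤ Real.exp 1 ^ 62 := by
        have := Real.exp_one_gt_d9
        gcongr; linarith
      rw [h4] at this
      have h3 : (240000:ℝ)^5 < 2.718^62 := by norm_num
      linarith
    have : Real.exp L = Real.exp 12.4 * Real.exp (L - 12.4) := by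
      rw [← Real.exp_add]; congr 1; ring
    rw [hxe, this]
    have h3 := Real.add_one_le_exp (L - 12.4)
    calc 240000 * (L - 11.4) ≤ Real.exp 12.4 * (L - 11.4) := by
          have : 0 ≤ L - 11.4 := by linarith
          gcongr
      _ ≤ _ := by gcongr; linarith
  set n := ⌊x⌋₊ with hn
  have hnx : (n:ℝ) ≤ x := Nat.floor_le hx.le
  have hxn : x < n + 1 := Nat.lt_floor_add_one x
  have hn2 : 200000 ≤ n := by
    apply Nat.le_floor
    push_cast
    linarith
  have hn0 : (0:ℝ) < n := by
    have : 0 < n := by omega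
    exact_mod_cast this
  have hlog : Real.log n ≤ L := Real.log_le_log hn0 hnx
  rw [Chebyshev.psi_eq_psi_coe_floor, ← hn]
  have := psi_lower n (by omega)
  have := psi_upper_nat n hn2
  constructor
  · linarith
  · intro h13
    linarith



lemma two_div_log_two : 2.885 ≤ 2 / Real.log 2 ∧ 2 / Real.log 2 ≤ 2.886 := by
  have a := Real.log_two_gt_d9
  have b := Real.log_two_lt_d9
  have h : 0 < Real.log 2 := by linarith
  rw [le_div_iff₀ h, div_le_iff₀ h]
  constructor <;> linarith

lemma red_up {x L p : ℝ} (hL : 0 < L) (h : p * L^3 ≤ (L + 7) * (x * (L + 1) - 2.886 * L^2)) :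
    p ≤ (1 + 7 / L) * (x * (1 / L + 1 / L^2) - 2 / Real.log 2) := by
  have hc := two_div_log_two.2
  have h1 : p ≤ (L + 7) * (x * (L + 1) - 2.886 * L^2) / L^3 := by
    rw [le_div_iff₀ (by positivity)]; exact h
  have h2 : (L + 7) * (x * (L + 1) - 2.886 * L^2) / L^3 =
      (1 + 7 / L) * (x * (1 / L + 1 / L^2) - 2.886) := by field_simp
  rw [h2] at h1
  refine h1.trans ?_
  gcongr

lemma red_low {x L p : ℝ} (hL : 0 < L) (h : x * (L + 1) ≤ (L + 7) * L * p + 2.885 * L^2) :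
    x * (1 / L + 1 / L^2) - 2 / Real.log 2 ≤ (1 + 7 / L) * p := by
  have hc := two_div_log_two.1
  have e1 : x * (1 / L + 1 / L^2) = x * (L + 1) / L^2 := by field_simp
  have e2 : (1 + 7 / L) * p = ((L + 7) * L * p + 2.885 * L^2) / L^2 - 2.885 := by field_simp; ring
  rw [e1, e2]
  have : x * (L + 1) / L^2 ≤ ((L + 7) * L * p + 2.885 * L^2) / L^2 := by gcongr
  linarith

lemma G_deriv {t : ℝ} (ht : 1 < t) :
    HasDerivAt (fun t => 2 * (t / Real.log t ^ 2)) (2 * ((1 - 2 / Real.log t) / Real.log t ^ 2)) t := by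
  have hl : 0 < Real.log t := Real.log_pos ht
  have ht0 : t ≠ 0 := by linarith
  have h1' : HasDerivAt (fun t => Real.log t ^ 2) (2 * Real.log t * t⁻¹) t :=
    ((Real.hasDerivAt_log ht0).fun_pow 2).congr_deriv (by norm_num)
  refine HasDerivAt.congr_deriv
    (((hasDerivAt_id' t).fun_div h1' (pow_pos hl 2).ne').const_mul 2) ?_
  field_simp

lemma int_piece {a b c : ℝ} (ha : 1 < a) (hab : a ≤ b) (hc : c = Real.log a) :
    ∫ t in a..b, 1 / Real.log t ^ 2 ≤ (b - a) * (1 / c ^ 2) := by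
  have hi := Chebyshev.intervalIntegrable_one_div_log_sq ha (ha.trans_le hab)
  calc ∫ t in a..b, 1 / Real.log t ^ 2 ≤ ∫ t in a..b, 1 / c ^ 2 := by
        refine intervalIntegral.integral_mono_on hab hi (by simp) ?_
        intro t ht
        have h0 : 0 < Real.log a := Real.log_pos ha
        have h1 : Real.log a ≤ Real.log t := Real.log_le_log (by linarith) ht.1
        rw [hc]
        gcongr
    _ = _ := by simp

lemma int_tail {x : ℝ} (hx : 64 ≤ x) :
    ∫ t in (64:ℝ)..x, 1 / Real.log t ^ 2 ≤
      2 * (x / Real.log x ^ 2) - 2 * (64 / Real.log 64 ^ 2) := by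
  have hi := Chebyshev.intervalIntegrable_one_div_log_sq (a := 64) (b := x) (by norm_num) (by linarith)
  have h64 : 4 ≤ Real.log 64 := by
    have a := Real.log_two_gt_d9
    rw [show (64:ℝ) = 2^6 by norm_num, Real.log_pow]; push_cast; linarith
  have hcont : ContinuousOn (fun t => 2 * ((1 - 2 / Real.log t) / Real.log t ^ 2)) (uIcc 64 x) := by
    rw [uIcc_of_le hx]
    intro t ht
    have hl : Real.log t ≠ 0 := (Real.log_pos (by linarith [ht.1])).ne'
    have ht0 : t ≠ 0 := by linarith [ht.1]
    apply ContinuousAt.continuousWithinAt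
    fun_prop (disch := first | assumption | positivity)
  have hii : IntervalIntegrable (fun t => 2 * ((1 - 2 / Real.log t) / Real.log t ^ 2)) volume 64 x :=
    hcont.intervalIntegrable
  have hF := intervalIntegral.integral_eq_sub_of_hasDerivAt (a := 64) (b := x)
    (f := fun t => 2 * (t / Real.log t ^ 2)) (fun t ht => by
      rw [uIcc_of_le hx] at ht
      exact G_deriv (by linarith [ht.1])) hii
  rw [← hF]
  refine intervalIntegral.integral_mono_on hx hi hii ?_
  intro t ht
  have hl : 4 ≤ Real.log t := h64.trans (Real.log_le_log (by norm_num) ht.1)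
  have hl0 : 0 < Real.log t := by linarith
  have h2 : 2 / Real.log t ≤ 1/2 := by rw [div_le_iff₀ hl0]; linarith
  rw [← mul_div_assoc]
  gcongr
  linarith

lemma int_bound {x : ℝ} (hx : 64 ≤ x) :
    ∫ t in (2:ℝ)..x, 1 / Real.log t ^ 2 ≤ 2 * (x / Real.log x ^ 2) + 10 := by
  have I : ∀ a b : ℝ, 1 < a → 1 < b → IntervalIntegrable (fun x => 1 / Real.log x ^ 2) volume a b :=
    fun a b h1 h2 => Chebyshev.intervalIntegrable_one_div_log_sq h1 h2
  have h1 := int_piece (a := 2) (b := 4) (c := Real.log 2) (by norm_num) (by norm_num) rfl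
  have h2 := int_piece (a := 4) (b := 16) (c := 2 * Real.log 2) (by norm_num) (by norm_num) (by
    rw [show (4:ℝ) = 2^2 by norm_num, Real.log_pow]; norm_num)
  have h3 := int_piece (a := 16) (b := 64) (c := 4 * Real.log 2) (by norm_num) (by norm_num) (by
    rw [show (16:ℝ) = 2^4 by norm_num, Real.log_pow]; norm_num)
  have h4 := int_tail hx
  have e64 : Real.log 64 = 6 * Real.log 2 := by
    rw [show (64:ℝ) = 2^6 by norm_num, Real.log_pow]; norm_num
  rw [e64] at h4
  rw [← intervalIntegral.integral_add_adjacent_intervals (I 2 64 (by norm_num) (by norm_num))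
    (I 64 x (by norm_num) (by linarith)),
    ← intervalIntegral.integral_add_adjacent_intervals (I 2 16 (by norm_num) (by norm_num))
    (I 16 64 (by norm_num) (by norm_num)),
    ← intervalIntegral.integral_add_adjacent_intervals (I 2 4 (by norm_num) (by norm_num))
    (I 4 16 (by norm_num) (by norm_num))]
  have a := Real.log_two_gt_d9
  have hk : 1 / Real.log 2 ^ 2 ≤ 2.1 := by
    rw [div_le_iff₀ (by positivity)]
    nlinarith
  have e2 : 1 / (2 * Real.log 2)^2 = 1/4 * (1 / Real.log 2 ^ 2) := by rw [mul_pow]; field_simp; norm_num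
  have e3 : 1 / (4 * Real.log 2)^2 = 1/16 * (1 / Real.log 2 ^ 2) := by rw [mul_pow]; field_simp; norm_num
  have e4 : 64 / (6 * Real.log 2)^2 = 64/36 * (1 / Real.log 2 ^ 2) := by rw [mul_pow]; field_simp; norm_num
  rw [e2] at h2
  rw [e3] at h3
  rw [e4] at h4
  linarith

lemma log_four_le : Real.log 4 ≤ 1.3863 := by
  have b := Real.log_two_lt_d9
  rw [show (4:ℝ) = 2^2 by norm_num, Real.log_pow]; push_cast; linarith

lemma pi_upper {x a : ℝ} (hx : 64 ≤ x) (ha : Chebyshev.theta x ≤ a * x) :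
    (Nat.primeCounting ⌊x⌋₊ : ℝ) ≤ a * x / Real.log x + 1.3863 * (2 * (x / Real.log x ^ 2) + 10) := by
  rw [Chebyshev.primeCounting_eq_theta_div_log_add_integral (by linarith)]
  have hl : 0 < Real.log x := Real.log_pos (by linarith)
  have hint : ∫ t in (2:ℝ)..x, Chebyshev.theta t / (t * Real.log t ^ 2) ≤
      ∫ t in (2:ℝ)..x, 1.3863 * (1 / Real.log t ^ 2) := by
    refine intervalIntegral.integral_mono_on (by linarith) ?_ ?_ ?_
    · rw [intervalIntegrable_iff_integrableOn_Icc_of_le (by linarith)]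
      exact Chebyshev.integrableOn_theta_div_id_mul_log_sq x
    · exact (Chebyshev.intervalIntegrable_one_div_log_sq (by norm_num) (by linarith)).const_mul _
    · intro t ht
      have ht0 : 0 < t := by linarith [ht.1]
      have hlt : 0 < Real.log t := Real.log_pos (by linarith [ht.1])
      have h1 := Chebyshev.theta_le_log4_mul_x ht0.le
      have h2 : Chebyshev.theta t ≤ 1.3863 * t := h1.trans (by gcongr; exact log_four_le)
      calc _ ≤ 1.3863 * t / (t * Real.log t ^ 2) := by gcongr
        _ = _ := by field_simp
  rw [intervalIntegral.integral_const_mul] at hint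
  have hb := int_bound hx
  have h3 : Chebyshev.theta x / Real.log x ≤ a * x / Real.log x := by gcongr
  linarith

lemma up_red {x a : ℝ} (hx : 64 ≤ x) (ha : Chebyshev.theta x ≤ a * x)
    (h : 16.749 * Real.log x ^ 3 + 20.202 * Real.log x ^ 2 ≤
      x * ((1 - a) * Real.log x ^ 2 + 5.2274 * Real.log x + 7)) :
    (Nat.primeCounting ⌊x⌋₊ : ℝ) ≤
      (1 + 7 / Real.log x) * (x * (1 / Real.log x + 1 / Real.log x ^ 2) - 2 / Real.log 2) := by
  have hl : 0 < Real.log x := Real.log_pos (by linarith)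
  have hp := pi_upper hx ha
  apply red_up hl
  set L := Real.log x
  have h1 : (Nat.primeCounting ⌊x⌋₊ : ℝ) * L^3 ≤
      (a * x / L + 1.3863 * (2 * (x / L ^ 2) + 10)) * L^3 := by gcongr
  have e : (a * x / L + 1.3863 * (2 * (x / L ^ 2) + 10)) * L^3 =
      a * x * L^2 + 2.7726 * x * L + 13.863 * L^3 := by field_simp; ring
  rw [e] at h1
  nlinarith

lemma exp_ge_five {L : ℝ} (hL : 0 ≤ L) : L^5/120 ≤ Real.exp L := by
  have := Real.pow_div_factorial_le_exp L hL 5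
  norm_num [Nat.factorial] at this
  exact this

lemma exp_ge_poly4 {L : ℝ} (hL : 0 ≤ L) : 1 + L + L^2/2 + L^3/6 + L^4/24 ≤ Real.exp L := by
  have := Real.sum_le_exp_of_nonneg hL 5
  norm_num [Finset.sum_range_succ, Nat.factorial] at this
  linarith

lemma upper_C (hRH : RiemannHypothesis) {x : ℝ} (hx : 64 ≤ x) (hL : 45 ≤ Real.log x) :
    (Nat.primeCounting ⌊x⌋₊ : ℝ) ≤
      (1 + 7 / Real.log x) * (x * (1 / Real.log x + 1 / Real.log x ^ 2) - 2 / Real.log 2) := by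
  have h := (abs_le.mp (psi_large hRH (by linarith) hL)).2
  have ht := Chebyshev.theta_le_psi x
  have h5 := exp_ge_five (L := Real.log x) (by linarith)
  rw [Real.exp_log (by linarith)] at h5
  refine up_red (a := 1 + 5 / Real.log x) hx ?_ ?_
  · have : (1 + 5 / Real.log x) * x = x + 5 * x / Real.log x := by ring
    linarith
  · set L := Real.log x
    have e : (1 - (1 + 5 / L)) * L^2 + 5.2274 * L + 7 = 0.2274 * L + 7 := by field_simp; ring
    rw [e]
    have hL2 : 2025 ≤ L^2 := by nlinarith
    have hL3 : 0 < L^3 := by positivity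
    have h6 : 16.749 * L^3 + 20.202 * L^2 ≤ 7 * (L^5/120) := by nlinarith
    nlinarith

lemma upper_B {x : ℝ} (hx : 64 ≤ x) (hL : 14 ≤ Real.log x) (hL2 : Real.log x ≤ 45) :
    (Nat.primeCounting ⌊x⌋₊ : ℝ) ≤
      (1 + 7 / Real.log x) * (x * (1 / Real.log x + 1 / Real.log x ^ 2) - 2 / Real.log 2) := by
  have h := (cheb_psi (x := x) (by linarith) (by linarith)).2 (by linarith)
  have ht := Chebyshev.theta_le_psi x
  have h5 := exp_ge_five (L := Real.log x) (by linarith)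
  rw [Real.exp_log (by linarith)] at h5
  refine up_red (a := 1.11) hx (by linarith) ?_
  set L := Real.log x
  have hq : 19 ≤ (1 - 1.11) * L^2 + 5.2274 * L + 7 := by nlinarith
  have hL2 : 196 ≤ L^2 := by nlinarith
  have hL3 : 0 < L^3 := by positivity
  have h6 : 16.749 * L^3 + 20.202 * L^2 ≤ 19 * (L^5/120) := by nlinarith
  nlinarith

lemma exp_465 : 100 ≤ Real.exp 4.65 := by
  have h4 : Real.exp 4.65 ^ 20 = Real.exp 1 ^ 93 := by
    rw [← Real.exp_nat_mul, ← Real.exp_nat_mul]; norm_num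
  by_contra hc
  push Not at hc
  have : Real.exp 4.65 ^ 20 ≤ 100^20 := by gcongr
  have h2 : (2.718:ℝ)^93 ≤ Real.exp 1 ^ 93 := by
    have := Real.exp_one_gt_d9
    gcongr; linarith
  rw [h4] at this
  have h3 : (100:ℝ)^20 < 2.718^93 := by norm_num
  linarith

lemma upper_A {x : ℝ} (hx : 0 < x) (hL : 4.65 ≤ Real.log x) (hL2 : Real.log x ≤ 14) :
    (Nat.primeCounting ⌊x⌋₊ : ℝ) ≤
      (1 + 7 / Real.log x) * (x * (1 / Real.log x + 1 / Real.log x ^ 2) - 2 / Real.log 2) := by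
  obtain ⟨v, hv⟩ : ∃ v, v = Real.log x - 4.65 := ⟨_, rfl⟩
  have hv0 : 0 ≤ v := by linarith
  have hxv : x = Real.exp 4.65 * Real.exp v := by
    rw [← Real.exp_add, hv]; ring_nf; rw [Real.exp_log hx]
  have hp : 1 + v + v^2/2 + v^3/6 ≤ Real.exp v := by
    have := exp_ge_poly4 hv0
    have : 0 ≤ v^4/24 := by positivity
    linarith
  have hxp : 100 * (1 + v + v^2/2 + v^3/6) ≤ x := by
    rw [hxv]
    have := exp_465
    gcongr
  have hx100 : 100 ≤ x := by
    have : 0 ≤ v + v^2/2 + v^3/6 := by positivity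
    linarith
  have ht := Chebyshev.theta_le_log4_mul_x hx.le
  refine up_red (a := 1.3863) (by linarith) (ht.trans (by gcongr; exact log_four_le)) ?_
  have hLv : Real.log x = v + 4.65 := by rw [hv]; ring
  rw [hLv] at hL2 ⊢
  have hv2 : 0 ≤ v^2 := by positivity
  have hv3 : 0 ≤ v^3 := by positivity
  rcases le_total v 5 with h5 | h5
  · have hq : 21.4 ≤ (1 - 1.3863) * (v + 4.65)^2 + 5.2274 * (v + 4.65) + 7 := by nlinarith
    calc _ ≤ 100 * (1 + v + v^2/2 + v^3/6) * 21.4 := by nlinarith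
      _ ≤ _ := by gcongr
  · have hq : 4.4 ≤ (1 - 1.3863) * (v + 4.65)^2 + 5.2274 * (v + 4.65) + 7 := by nlinarith
    calc _ ≤ 100 * (1 + v + v^2/2 + v^3/6) * 4.4 := by
            obtain ⟨w, hw⟩ : ∃ w, v = w + 5 := ⟨v - 5, by ring⟩
            have hw0 : 0 ≤ w := by linarith
            have hw2 : 0 ≤ w^2 := by positivity
            have hw3 : 0 ≤ w^3 := by positivity
            rw [hw]
            nlinarith
      _ ≤ _ := by gcongr

lemma pi_half {x : ℝ} (hx : 2 < x) : (Nat.primeCounting ⌊x⌋₊ : ℝ) ≤ (x + 2) / 2 := by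
  set m := ⌊x⌋₊ with hm
  have hm2 : 2 ≤ m := Nat.le_floor (by exact_mod_cast hx.le)
  have hmx : (m:ℝ) ≤ x := Nat.floor_le (by linarith)
  have h := Nat.primeCounting'_add_le (a := 2) (k := 3) (by norm_num) (by norm_num) (m - 2)
  have e : 3 + (m - 2) = m + 1 := by omega
  rw [e] at h
  have h3 : Nat.primeCounting' 3 = 1 := by decide
  have ht : Nat.totient 2 = 1 := by decide
  rw [h3, ht] at h
  have h' : Nat.primeCounting m ≤ 1 + 1 * ((m - 2)/2 + 1) := h
  have h'' : 2 * Nat.primeCounting m ≤ m + 2 := by omega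
  have : 2 * (Nat.primeCounting m : ℝ) ≤ m + 2 := by exact_mod_cast h''
  linarith

lemma upper_D {x : ℝ} (hx : 2 < x) (hL2 : Real.log x ≤ 4.65) :
    (Nat.primeCounting ⌊x⌋₊ : ℝ) ≤
      (1 + 7 / Real.log x) * (x * (1 / Real.log x + 1 / Real.log x ^ 2) - 2 / Real.log 2) := by
  have hl : 0 < Real.log x := Real.log_pos (by linarith)
  apply red_up hl
  have hp := pi_half hx
  have h4 := exp_ge_poly4 hl.le
  rw [Real.exp_log (by linarith)] at h4
  set L := Real.log x with hLd
  have h1 : (Nat.primeCounting ⌊x⌋₊ : ℝ) * L^3 ≤ (x + 2) / 2 * L^3 := by gcongr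
  refine h1.trans ?_
  suffices 3.886 * L^3 + 20.202 * L^2 ≤ x * (7 + 8 * L + L^2 - L^3/2) by nlinarith
  have hL2 : 0 < L^2 := by positivity
  have hL3 : 0 < L^3 := by positivity
  have hL4 : 0 < L^4 := by positivity
  rcases le_total L 2 with h2 | h2
  · have hq : 7 + 8 * L ≤ 7 + 8 * L + L^2 - L^3/2 := by nlinarith
    calc _ ≤ (1 + L + L^2/2 + L^3/6 + L^4/24) * (7 + 8 * L) := by
          have : 0 ≤ L^5 := by positivity
          nlinarith [mul_nonneg hl.le (sq_nonneg (L - 2)), sq_nonneg (L-2)]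
      _ ≤ _ := by gcongr
  rcases le_total L 4 with h3 | h3
  · have hq : 23 ≤ 7 + 8 * L + L^2 - L^3/2 := by
      have : 0 ≤ (L - 2) * (4 - L) * (L + 4) := by
        apply mul_nonneg (mul_nonneg _ _) <;> linarith
      nlinarith
    calc _ ≤ (1 + L + L^2/2 + L^3/6 + L^4/24) * 23 := by
          nlinarith [sq_nonneg (L^2 - 5), sq_nonneg (L - 3)]
      _ ≤ _ := by gcongr
  · have hq : 15 ≤ 7 + 8 * L + L^2 - L^3/2 := by
      have : 0 ≤ (4.65 - L) * (L^2 + 2.65 * L + 4) := by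
        apply mul_nonneg <;> nlinarith
      nlinarith
    have hx5 : (1 + L + L^2/2 + L^3/6 + L^4/24) + L^5/120 ≤ x := by
      have := Real.sum_le_exp_of_nonneg hl.le 6
      norm_num [Finset.sum_range_succ, Nat.factorial] at this
      rw [Real.exp_log (by linarith)] at this
      linarith
    calc _ ≤ ((1 + L + L^2/2 + L^3/6 + L^4/24) + L^5/120) * 15 := by
          obtain ⟨w, hw⟩ : ∃ w, L = w + 4 := ⟨L - 4, by ring⟩
          have hw0 : 0 ≤ w := by linarith
          have hw2 : 0 ≤ w^2 := by positivity
          have hw3 : 0 ≤ w^3 := by positivity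
          have hw4 : 0 ≤ w^4 := by positivity
          have hw5 : 0 ≤ w^5 := by positivity
          rw [hw]
          nlinarith
      _ ≤ _ := by gcongr

lemma lower_BC {x b : ℝ} (hx : 2 < x) (hb : b * x ≤ Chebyshev.psi x)
    (h : Real.log x + 1 ≤ (Real.log x + 7) * b) :
    x * (1 / Real.log x + 1 / Real.log x ^ 2) - 2 / Real.log 2 ≤
      (1 + 7 / Real.log x) * (Nat.primeCounting ⌊x⌋₊ : ℝ) := by
  have hl : 0 < Real.log x := Real.log_pos (by linarith)
  apply red_low hl
  have hp := Chebyshev.psi_le_primeCounting_mul_log' x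
  set L := Real.log x
  have h1 : (L + 7) * (b * x) ≤ (L + 7) * ((Nat.primeCounting ⌊x⌋₊ : ℝ) * L) := by
    have := hb.trans hp
    gcongr
  have h2 : x * (L + 1) ≤ x * ((L + 7) * b) := by gcongr
  nlinarith [sq_nonneg L]

lemma lower_A {x : ℝ} (hx : 5 ≤ x) (hL2 : Real.log x ≤ 12.4) :
    x * (1 / Real.log x + 1 / Real.log x ^ 2) - 2 / Real.log 2 ≤
      (1 + 7 / Real.log x) * (Nat.primeCounting ⌊x⌋₊ : ℝ) := by
  have hx0 : 0 < x := by linarith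
  have hl : 0 < Real.log x := Real.log_pos (by linarith)
  apply red_low hl
  have hp := (Chebyshev.psi_ge' hx0.le).trans (Chebyshev.psi_le_primeCounting_mul_log' x)
  have hlog2 : Real.log (x + 2) ≤ Real.log x + 0.4 := by
    have h1 : Real.log ((x + 2) / x) ≤ (x + 2) / x - 1 := Real.log_le_sub_one_of_pos (by positivity)
    rw [Real.log_div (by positivity) (by positivity)] at h1
    have h2 : (x + 2) / x - 1 ≤ 0.4 := by
      rw [sub_le_iff_le_add, div_le_iff₀ hx0]; linarith
    linarith
  have hL5 : 1.609 ≤ Real.log x := by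
    have c3 := log_pow_le (a := 2) (b := 5) (k := 65) (l := 28) (by norm_num) (by norm_num)
    push_cast at c3
    have a := Real.log_two_gt_d9
    have : Real.log 5 ≤ Real.log x := Real.log_le_log (by norm_num) hx
    linarith
  have h4 := exp_ge_poly4 hl.le
  rw [Real.exp_log (by linarith)] at h4
  set L := Real.log x with hLd
  set p := (Nat.primeCounting ⌊x⌋₊ : ℝ) with hpd
  have a := Real.log_two_gt_d9
  have b := Real.log_two_lt_d9
  have hp2 : 0.6931471 * x - L - 1.0932 ≤ p * L := by nlinarith
  have h1 : (L + 7) * (0.6931471 * x - L - 1.0932) ≤ (L + 7) * (p * L) := by gcongr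
  suffices x * (L + 1) ≤ (L + 7) * (0.6931471 * x - L - 1.0932) + 2.885 * L^2 by linarith
  suffices 0 ≤ x * (3.852 - 0.3068529 * L) + 1.885 * L^2 - 8.0932 * L - 7.6524 by nlinarith
  rcases le_total L 1.8 with h2 | h2
  · nlinarith
  rcases le_total L 5.2 with h3 | h3
  · have hq : 0 ≤ 3.852 - 0.3068529 * L := by linarith
    have hx3 : 1 + L + L^2/2 + L^3/6 ≤ x := by
      have : 0 ≤ L^4/24 := by positivity
      linarith
    have : (1 + L + L^2/2 + L^3/6) * (3.852 - 0.3068529 * L) ≤ x * (3.852 - 0.3068529 * L) := by gcongr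
    obtain ⟨w, hw⟩ : ∃ w, L = w + 1.8 := ⟨L - 1.8, by ring⟩
    have hw0 : 0 ≤ w := by linarith
    have hw1 : w ≤ 3.4 := by linarith
    have hw3 : 0 ≤ w^3 * (3.4 - w) := by
      apply mul_nonneg (by positivity); linarith
    rw [hw] at this ⊢
    nlinarith [pow_nonneg hw0 2, pow_nonneg hw0 3]
  · have hq : 0 ≤ x * (3.852 - 0.3068529 * L) := by
      apply mul_nonneg hx0.le; linarith
    nlinarith

lemma lower_D {x : ℝ} (hx : 2 < x) (hx5 : x ≤ 5) :
    x * (1 / Real.log x + 1 / Real.log x ^ 2) - 2 / Real.log 2 ≤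
      (1 + 7 / Real.log x) * (Nat.primeCounting ⌊x⌋₊ : ℝ) := by
  have hl : 0 < Real.log x := Real.log_pos (by linarith)
  apply red_low hl
  have hm2 : 2 ≤ ⌊x⌋₊ := Nat.le_floor (by exact_mod_cast hx.le)
  have hp : (1:ℝ) ≤ (Nat.primeCounting ⌊x⌋₊ : ℝ) := by
    have h1 := Nat.monotone_primeCounting hm2
    have h2 : Nat.primeCounting 2 = 1 := by decide
    rw [h2] at h1
    exact_mod_cast h1
  have a := Real.log_two_gt_d9
  have h2 : Real.log 2 ≤ Real.log x := Real.log_le_log (by norm_num) hx.le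
  set L := Real.log x with hLd
  have h1 : (L + 7) * L * 1 ≤ (L + 7) * L * (Nat.primeCounting ⌊x⌋₊ : ℝ) := by gcongr
  refine le_trans ?_ (add_le_add_left h1 _)
  rcases le_total x 3 with h3 | h3
  · have : x * (L + 1) ≤ 3 * (L + 1) := by gcongr
    nlinarith
  · have c1 := log_pow_le (a := 2) (b := 3) (k := 19) (l := 12) (by norm_num) (by norm_num)
    push_cast at c1
    have h4 : Real.log 3 ≤ L := Real.log_le_log (by norm_num) h3
    have : x * (L + 1) ≤ 5 * (L + 1) := by gcongr
    have hL1 : 1.09 ≤ L := by linarith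
    nlinarith

lemma final_bounds (hRH : RiemannHypothesis) {x : ℝ} (hx : 2 < x) :
    (Nat.primeCounting ⌊x⌋₊ : ℝ) ≤
      (1 + 7 / Real.log x) * (x * (1 / Real.log x + 1 / Real.log x ^ 2) - 2 / Real.log 2) ∧
    x * (1 / Real.log x + 1 / Real.log x ^ 2) - 2 / Real.log 2 ≤
      (1 + 7 / Real.log x) * (Nat.primeCounting ⌊x⌋₊ : ℝ) := by
  have hx0 : 0 < x := by linarith
  have h64 : 14 ≤ Real.log x → 64 ≤ x := by
    intro h
    have h5 := exp_ge_five (L := Real.log x) (by linarith)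
    rw [Real.exp_log hx0] at h5
    have : (14:ℝ)^5 ≤ Real.log x ^ 5 := by gcongr
    linarith
  constructor
  · rcases le_total (Real.log x) 4.65 with h | h
    · exact upper_D hx h
    rcases le_total (Real.log x) 14 with h2 | h2
    · exact upper_A hx0 h h2
    rcases le_total (Real.log x) 45 with h3 | h3
    · exact upper_B (h64 h2) h2 h3
    · exact upper_C hRH (h64 h2) h3
  · rcases le_total x 5 with h | h
    · exact lower_D hx h
    rcases le_total (Real.log x) 12.4 with h2 | h2
    · exact lower_A h h2
    rcases le_total (Real.log x) 45 with h3 | h3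
    · exact lower_BC hx (cheb_psi hx0 h2).1 (by linarith)
    · have h4 := (abs_le.mp (psi_large hRH hx0 h3)).1
      have hl : 0 < Real.log x := by linarith
      refine lower_BC (b := 1 - 5 / Real.log x) hx ?_ ?_
      · have : (1 - 5 / Real.log x) * x = x - 5 * x / Real.log x := by ring
        linarith
      · have : (Real.log x + 7) * (1 - 5 / Real.log x) = Real.log x + 2 - 35 / Real.log x := by
          field_simp; ring
        rw [this]
        have : 35 / Real.log x ≤ 1 := by rw [div_le_one hl]; linarith
        linarith


end RHProof

/-- Assuming RH, for all `x > 2`, `π(x)` is within a factor of `1 + 7/log x` of `A(x)`. -/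
theorem stmt5 (hRH : RiemannHypothesis) (x : ℝ) (hx : 2 < x) :
    (primePi x : ℝ) ≤ (1 + 7 / Real.log x) * approxA x ∧
    approxA x ≤ (1 + 7 / Real.log x) * (primePi x : ℝ) := by
  exact final_bounds hRH hx
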